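/- arXiv:1007.3091 — 6 statements merged into one kernel-verified Lean document; each statement's English description precedes it below -/
import Mathlib

section
/- For every 0 ≤ d ≤ n, the multiplication map R_n^d × R_n^{n−d} → R_n^n is a perfect pairing of finite-dimensional Q-vector spaces; that is, if x ∈ R_n^d satisfies x·y = 0 for every y ∈ R_n^{n−d}, then x = 0, and symmetrically in the second argument. (Here R_n^n is the one-dimensional top graded piece, so the pairing takes values in a space isomorphic to Q.) -/
open MvPolynomial

namespace TautCt

/-- The polynomial ring ℚ[a_i, b_{jk}] with variables `a i` for `i : Fin n` and
`b s` for `s` an off-diagonal unordered pair of elements of `Fin n`. -/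
abbrev Pn (n : ℕ) : Type := MvPolynomial (Fin n ⊕ {s : Sym2 (Fin n) // ¬ s.IsDiag}) ℚ

/-- The generator `a_i`. -/
noncomputable def aP (n : ℕ) (i : Fin n) : Pn n := X (Sum.inl i)

/-- The generator `b_s` for an unordered pair `s` (junk value `0` on the diagonal). -/
noncomputable def bS (n : ℕ) (s : Sym2 (Fin n)) : Pn n :=
  if h : s.IsDiag then 0 else X (Sum.inr ⟨s, h⟩)

/-- The generator `b_{i,j} = b_{j,i}`. -/
noncomputable def bP (n : ℕ) (i j : Fin n) : Pn n := bS n s(i, j)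

/-- The defining relations of the tautological ring `R_n`. -/
def relSet (n : ℕ) : Set (Pn n) :=
  { x | (∃ i, x = aP n i ^ 2) ∨
        (∃ i j, i ≠ j ∧ x = aP n i * bP n i j) ∨
        (∃ i j, i ≠ j ∧ x = bP n i j ^ 2 + 2 * (aP n i * aP n j)) ∨
        (∃ i j k, i ≠ j ∧ i ≠ k ∧ j ≠ k ∧
          x = bP n i j * bP n i k - aP n i * bP n j k) ∨
        (∃ i j k l, i ≠ j ∧ i ≠ k ∧ i ≠ l ∧ j ≠ k ∧ j ≠ l ∧ k ≠ l ∧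
          x = bP n i j * bP n k l + bP n i k * bP n j l + bP n i l * bP n j k) }

noncomputable def relIdeal (n : ℕ) : Ideal (Pn n) := Ideal.span (relSet n)

/-- The tautological ring `R_n = R^*(C^n)`. -/
abbrev Rn (n : ℕ) : Type := Pn n ⧸ relIdeal n

noncomputable def mkR (n : ℕ) : Pn n →ₐ[ℚ] Rn n := Ideal.Quotient.mkₐ ℚ (relIdeal n)

/-- The degree-`d` graded piece `R_n^d`: the image of the homogeneous degree-`d`
polynomials under the quotient map. -/
noncomputable def Rgrade (n d : ℕ) : Submodule ℚ (Rn n) :=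
  (homogeneousSubmodule (Fin n ⊕ {s : Sym2 (Fin n) // ¬ s.IsDiag}) ℚ d).map
    (mkR n).toLinearMap

/-- `M` is a perfect matching of the subset `B ⊆ {1,…,n}`. -/
def IsMatching (n : ℕ) (B : Finset (Fin n)) (M : Finset (Sym2 (Fin n))) : Prop :=
  (∀ s ∈ M, ¬ s.IsDiag) ∧
  (∀ s ∈ M, ∀ t ∈ M, s ≠ t → ∀ a : Fin n, a ∈ s → a ∉ t) ∧
  (∀ a : Fin n, a ∈ B ↔ ∃ s ∈ M, a ∈ s)

/-- The standard monomial `∏_{i ∈ A} a_i · ∏_{{j,k} ∈ M} b_{j,k}`. -/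
noncomputable def stdMon (n : ℕ) (A : Finset (Fin n)) (M : Finset (Sym2 (Fin n))) : Pn n :=
  (∏ i ∈ A, aP n i) * ∏ s ∈ M, bS n s

/-! ### An exterior algebra model -/

section Model

variable {n : ℕ}

/-- The exterior algebra on generators `e_{i,0}`, `e_{i,1}`. -/
abbrev ExtModel (n : ℕ) : Type := ExteriorAlgebra ℚ (Fin n × Fin 2 → ℚ)

/-- The odd generator `e_{i,c}`. -/
noncomputable def oddGen (i : Fin n) (c : Fin 2) : ExtModel n :=
  ExteriorAlgebra.ι ℚ (Pi.single (i, c) 1)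

theorem oddGen_sq (i : Fin n) (c : Fin 2) : oddGen i c * oddGen i c = 0 :=
  ExteriorAlgebra.ι_sq_zero _

theorem oddGen_anticomm (i j : Fin n) (c d : Fin 2) :
    oddGen i c * oddGen j d = -(oddGen j d * oddGen i c) :=
  eq_neg_of_add_eq_zero_left (ExteriorAlgebra.ι_add_mul_swap _ _)

theorem ι_mul_ι_mem_center (u v : Fin n × Fin 2 → ℚ) :
    ExteriorAlgebra.ι ℚ u * ExteriorAlgebra.ι ℚ v ∈ Subalgebra.center ℚ (ExtModel n) := by
  rw [Subalgebra.mem_center_iff]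
  intro x
  induction x using ExteriorAlgebra.induction with
  | algebraMap r => exact Algebra.commutes r _
  | ι w =>
    have h1 : ExteriorAlgebra.ι ℚ w * ExteriorAlgebra.ι ℚ u
        = -(ExteriorAlgebra.ι ℚ u * ExteriorAlgebra.ι ℚ w) :=
      eq_neg_of_add_eq_zero_left (ExteriorAlgebra.ι_add_mul_swap _ _)
    have h2 : ExteriorAlgebra.ι ℚ w * ExteriorAlgebra.ι ℚ v
        = -(ExteriorAlgebra.ι ℚ v * ExteriorAlgebra.ι ℚ w) :=
      eq_neg_of_add_eq_zero_left (ExteriorAlgebra.ι_add_mul_swap _ _)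
    rw [← mul_assoc, h1, neg_mul, mul_assoc, h2, mul_neg, neg_neg, mul_assoc]
  | mul x y hx hy => rw [mul_assoc, hy, ← mul_assoc, hx, mul_assoc]
  | add x y hx hy => rw [add_mul, mul_add, hx, hy]

/-- The central element `e_{i,0} e_{j,1}` of the exterior model. -/
noncomputable def evenGen (i j : Fin n) : Subalgebra.center ℚ (ExtModel n) :=
  ⟨oddGen i 0 * oddGen j 1, ι_mul_ι_mem_center _ _⟩

theorem coe_evenGen (i j : Fin n) : (evenGen i j : ExtModel n) = oddGen i 0 * oddGen j 1 := rfl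

theorem evenGen_swap (i j k l : Fin n) :
    evenGen i j * evenGen k l + evenGen i l * evenGen k j = 0 := by
  apply Subtype.ext
  rw [Subalgebra.coe_add, Subalgebra.coe_mul, Subalgebra.coe_mul, Subalgebra.coe_zero]
  simp only [coe_evenGen]
  have h (x y : Fin n) : oddGen i 0 * oddGen x 1 * (oddGen k 0 * oddGen y 1)
      = -(oddGen i 0 * oddGen k 0 * (oddGen x 1 * oddGen y 1)) := by
    rw [mul_assoc, ← mul_assoc (oddGen x 1), oddGen_anticomm x k 1 0]
    simp only [neg_mul, mul_neg, mul_assoc]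
  rw [h, h, oddGen_anticomm j l]
  simp

theorem evenGen_mul_of_left_eq (i j k : Fin n) : evenGen i j * evenGen i k = 0 := by
  apply Subtype.ext
  rw [Subalgebra.coe_mul, Subalgebra.coe_zero]
  simp only [coe_evenGen]
  rw [oddGen_anticomm i j, neg_mul, mul_assoc, ← mul_assoc (oddGen i 0), oddGen_sq]
  simp

theorem evenGen_mul_of_right_eq (i j k : Fin n) : evenGen j i * evenGen k i = 0 := by
  apply Subtype.ext
  rw [Subalgebra.coe_mul, Subalgebra.coe_zero]
  simp only [coe_evenGen]
  rw [oddGen_anticomm k i, mul_neg, mul_assoc, ← mul_assoc (oddGen i 1), oddGen_sq]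
  simp

/-- The quadratic relations satisfied by `a_i = w_{ii}` and `b_{ij} = -(w_{ij} + w_{ji})`, when
products `w_{ij} w_{kl}` are alternating in the rows and in the columns. -/
theorem alternating_relations {ι S : Type*} [CommRing S] (w : ι → ι → S)
    (hs : ∀ i j k l, w i j * w k l + w i l * w k j = 0)
    (hl : ∀ i j k, w i j * w i k = 0) (hr : ∀ i j k, w j i * w k i = 0) (i j k l : ι) :
    w i i * -(w i j + w j i) = 0 ∧
    (-(w i j + w j i)) ^ 2 + 2 * (w i i * w j j) = 0 ∧
    -(w i j + w j i) * -(w i k + w k i) - w i i * -(w j k + w k j) = 0 ∧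
    -(w i j + w j i) * -(w k l + w l k) + -(w i k + w k i) * -(w j l + w l j)
      + -(w i l + w l i) * -(w j k + w k j) = 0 := by
  refine ⟨?_, ?_, ?_, ?_⟩
  · linear_combination -hl i i j - hr i i j
  · linear_combination hl i j j + hl j i i + 2 * hs i j j i
  · linear_combination hl i j k + hs i j k i + hs j i i k + hr i j k
  · linear_combination hs i j k l + hs i j l k + hs j i k l + hs j i l k + hs i k j l
      + hs k i l j

/-- The algebra homomorphism from the polynomial ring to the exterior model. -/
noncomputable def toModel (n : ℕ) : Pn n →ₐ[ℚ] Subalgebra.center ℚ (ExtModel n) :=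
  aeval (Sum.elim (fun i => evenGen i i)
    (fun s => Sym2.lift ⟨fun i j => -(evenGen i j + evenGen j i),
      fun i j => by simp only [add_comm]⟩ s.1))

theorem toModel_aP (i : Fin n) : toModel n (aP n i) = evenGen i i := by
  simp [toModel, aP]

theorem toModel_bP {i j : Fin n} (h : i ≠ j) :
    toModel n (bP n i j) = -(evenGen i j + evenGen j i) := by
  have h' : ¬ (s(i, j)).IsDiag := by simpa using h
  rw [bP, bS, dif_neg h', toModel, aeval_X]
  simp

theorem toModel_eq_zero {x : Pn n} (hx : x ∈ relIdeal n) : toModel n x = 0 := by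
  have key := alternating_relations (evenGen (n := n)) evenGen_swap evenGen_mul_of_left_eq
    evenGen_mul_of_right_eq
  have : relIdeal n ≤ RingHom.ker (toModel n) := by
    rw [relIdeal, Ideal.span_le]
    rintro x (⟨i, rfl⟩ | ⟨i, j, h, rfl⟩ | ⟨i, j, h, rfl⟩ | ⟨i, j, k, hij, hik, hjk, rfl⟩ |
      ⟨i, j, k, l, hij, hik, hil, hjk, hjl, hkl, rfl⟩)
    · rw [SetLike.mem_coe, RingHom.mem_ker, map_pow, toModel_aP, pow_two, evenGen_mul_of_left_eq]
    · rw [SetLike.mem_coe, RingHom.mem_ker, map_mul, toModel_aP, toModel_bP h]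
      exact (key i j j j).1
    · rw [SetLike.mem_coe, RingHom.mem_ker, map_add, map_pow, map_mul, map_mul, map_ofNat,
        toModel_aP, toModel_aP, toModel_bP h]
      exact (key i j j j).2.1
    · rw [SetLike.mem_coe, RingHom.mem_ker, map_sub, map_mul, map_mul, toModel_aP,
        toModel_bP hij, toModel_bP hik, toModel_bP hjk]
      exact (key i j k k).2.2.1
    · rw [SetLike.mem_coe, RingHom.mem_ker, map_add, map_add, map_mul, map_mul, map_mul,
        toModel_bP hij, toModel_bP hik, toModel_bP hil, toModel_bP hjk, toModel_bP hjl,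
        toModel_bP hkl]
      exact (key i j k l).2.2.2
  exact this hx

/-- Contraction with the coordinate dual to `e_{i,c}`. -/
noncomputable def contr (i : Fin n) (c : Fin 2) : ExtModel n →ₗ[ℚ] ExtModel n :=
  CliffordAlgebra.contractLeft (Q := (0 : QuadraticForm ℚ (Fin n × Fin 2 → ℚ)))
    (LinearMap.proj (i, c))

theorem contr_oddGen_mul_self (i : Fin n) (c : Fin 2) (x : ExtModel n) :
    contr i c (oddGen i c * x) = x - oddGen i c * contr i c x := by
  have := CliffordAlgebra.contractLeft_ι_mul (Q := (0 : QuadraticForm ℚ (Fin n × Fin 2 → ℚ)))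
    (d := LinearMap.proj (i, c)) (Pi.single (i, c) 1) x
  rw [LinearMap.proj_apply, Pi.single_eq_same, one_smul] at this
  exact this

theorem contr_oddGen_mul_of_ne {i j : Fin n} {c d : Fin 2} (h : (i, c) ≠ (j, d))
    (x : ExtModel n) : contr i c (oddGen j d * x) = -(oddGen j d * contr i c x) := by
  have := CliffordAlgebra.contractLeft_ι_mul (Q := (0 : QuadraticForm ℚ (Fin n × Fin 2 → ℚ)))
    (d := LinearMap.proj (i, c)) (Pi.single (j, d) 1) x
  rw [LinearMap.proj_apply, Pi.single_eq_of_ne h, zero_smul, zero_sub] at this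
  exact this

theorem prod_evenGen_ne_zero (S : Finset (Fin n)) :
    ∏ i ∈ S, evenGen i i ≠ (0 : Subalgebra.center ℚ (ExtModel n)) := by
  have key : ((∏ i ∈ S, evenGen i i : Subalgebra.center ℚ (ExtModel n)) : ExtModel n) ≠ 0 ∧
      ∀ j ∉ S, ∀ c, contr j c
        ((∏ i ∈ S, evenGen i i : Subalgebra.center ℚ (ExtModel n)) : ExtModel n) = 0 := by
    induction S using Finset.induction_on with
    | empty =>
      refine ⟨by simp, fun j _ c => ?_⟩
      simp [contr, CliffordAlgebra.contractLeft_one]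
    | insert i S hi ih =>
      rw [Finset.prod_insert hi, Subalgebra.coe_mul, coe_evenGen, mul_assoc]
      refine ⟨fun h0 => ih.1 ?_, fun j hj c => ?_⟩
      · have h1 := congrArg (contr i 1) (congrArg (contr i 0) h0)
        rw [contr_oddGen_mul_self, contr_oddGen_mul_of_ne (by simp), ih.2 i hi 0] at h1
        simpa [contr_oddGen_mul_self, ih.2 i hi 1] using h1
      · rw [Finset.mem_insert, not_or] at hj
        rw [contr_oddGen_mul_of_ne (by simp [hj.1]), contr_oddGen_mul_of_ne (by simp [hj.1]),
          ih.2 j hj.2]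
        simp
  exact fun h => key.1 (by rw [h]; rfl)

end Model

/-! ### Relations in the tautological ring -/

section Ring

variable {n : ℕ}

/-- The class of `a_i` in `R_n`. -/
noncomputable def ra (i : Fin n) : Rn n := mkR n (aP n i)

/-- The class of `b_{i,j}` in `R_n`. -/
noncomputable def rb (i j : Fin n) : Rn n := mkR n (bP n i j)

theorem mkR_eq_zero {x : Pn n} (hx : x ∈ relSet n) : mkR n x = 0 :=
  Ideal.Quotient.eq_zero_iff_mem.mpr (Ideal.subset_span hx)

theorem rb_comm (i j : Fin n) : rb i j = rb j i := by
  rw [rb, rb, bP, bP, Sym2.eq_swap]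

theorem ra_mul_self (i : Fin n) : ra i * ra i = 0 := by
  rw [ra, ← map_mul, ← pow_two]
  exact mkR_eq_zero (Or.inl ⟨i, rfl⟩)

theorem ra_mul_rb {i j : Fin n} (h : i ≠ j) : ra i * rb i j = 0 := by
  rw [ra, rb, ← map_mul]
  exact mkR_eq_zero (Or.inr (Or.inl ⟨i, j, h, rfl⟩))

theorem rb_mul_self {i j : Fin n} (h : i ≠ j) : rb i j * rb i j = -2 * (ra i * ra j) := by
  have := mkR_eq_zero (n := n) (Or.inr (Or.inr (Or.inl ⟨i, j, h, rfl⟩)))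
  rw [map_add, map_pow, map_mul, map_mul, map_ofNat] at this
  change rb i j ^ 2 + 2 * (ra i * ra j) = 0 at this
  linear_combination this

theorem rb_mul_rb {i j k : Fin n} (hij : i ≠ j) (hik : i ≠ k) (hjk : j ≠ k) :
    rb i j * rb i k = ra i * rb j k := by
  have := mkR_eq_zero (n := n) (Or.inr (Or.inr (Or.inr (Or.inl ⟨i, j, k, hij, hik, hjk, rfl⟩))))
  rw [map_sub, map_mul, map_mul] at this
  exact sub_eq_zero.mp this

theorem rb_plucker {i j k l : Fin n} (hij : i ≠ j) (hik : i ≠ k) (hil : i ≠ l) (hjk : j ≠ k)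
    (hjl : j ≠ l) (hkl : k ≠ l) :
    rb i j * rb k l + rb i k * rb j l + rb i l * rb j k = 0 := by
  have := mkR_eq_zero (n := n)
    (Or.inr (Or.inr (Or.inr (Or.inr ⟨i, j, k, l, hij, hik, hil, hjk, hjl, hkl, rfl⟩))))
  rw [map_add, map_add, map_mul, map_mul, map_mul] at this
  exact this

theorem neg_two_smul (x : Rn n) : (-2 : ℚ) • x = -2 * x := by
  refine (Algebra.smul_def (-2 : ℚ) x).trans ?_
  rw [map_neg, map_ofNat]

/-- The product `∏_{i ∈ A} a_i` in `R_n`. -/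
noncomputable def raProd (A : Finset (Fin n)) : Rn n := ∏ i ∈ A, ra i

theorem raProd_insert {i : Fin n} {A : Finset (Fin n)} (h : i ∉ A) :
    raProd (insert i A) = ra i * raProd A := Finset.prod_insert h

theorem ra_mul_raProd_of_mem {i : Fin n} {A : Finset (Fin n)} (h : i ∈ A) :
    ra i * raProd A = 0 := by
  rw [raProd, ← Finset.mul_prod_erase _ _ h, ← mul_assoc, ra_mul_self, zero_mul]

theorem raProd_ne_zero (A : Finset (Fin n)) : raProd A ≠ 0 := by
  intro h
  have h1 : mkR n (∏ i ∈ A, aP n i) = 0 := by rw [map_prod]; exact h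
  have h2 := toModel_eq_zero (Ideal.Quotient.eq_zero_iff_mem.mp h1)
  rw [map_prod] at h2
  simp only [toModel_aP] at h2
  exact prod_evenGen_ne_zero A h2

/-- `IsMatchProd B x` says that `x` is the product of the `b_{j,k}` over the edges `{j,k}` of a
perfect matching of `B`. -/
inductive IsMatchProd : Finset (Fin n) → Rn n → Prop
  | one : IsMatchProd ∅ 1
  | mul {i j : Fin n} {B : Finset (Fin n)} {x : Rn n} (hij : i ≠ j) (hi : i ∉ B) (hj : j ∉ B)
      (hx : IsMatchProd B x) : IsMatchProd (insert i (insert j B)) (rb i j * x)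

theorem IsMatchProd.exists_eq_mul {B : Finset (Fin n)} {x : Rn n} (hx : IsMatchProd B x)
    {i : Fin n} (hi : i ∈ B) : ∃ k C y, i ≠ k ∧ i ∉ C ∧ k ∉ C ∧ B = insert i (insert k C) ∧
      IsMatchProd C y ∧ x = rb i k * y := by
  induction hx with
  | one => simp at hi
  | @mul p q B x hpq hp hq hx ih =>
    by_cases hip : i = p
    · subst hip
      exact ⟨q, B, x, hpq, hp, hq, rfl, hx, rfl⟩
    by_cases hiq : i = q
    · subst hiq
      exact ⟨p, B, x, hpq.symm, hq, hp, Finset.insert_comm _ _ _, hx, by rw [rb_comm]⟩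
    have hiB : i ∈ B := by simpa [hip, hiq] using hi
    obtain ⟨k, C, y, hik, hiC, hkC, rfl, hy, rfl⟩ := ih hiB
    simp only [Finset.mem_insert, not_or] at hp hq
    refine ⟨k, insert p (insert q C), rb p q * y, hik, ?_, ?_, ?_, .mul hpq hp.2.2 hq.2.2 hy,
      by ring⟩
    · simp [hip, hiq, hiC]
    · simp [hkC, Ne.symm hp.2.1, Ne.symm hq.2.1]
    · ext t; simp only [Finset.mem_insert]; tauto

theorem IsMatchProd.eq_one {x : Rn n} (hx : IsMatchProd ∅ x) : x = 1 := by
  generalize hB : (∅ : Finset (Fin n)) = B at hx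
  cases hx with
  | one => rfl
  | mul => exact absurd hB.symm (Finset.insert_ne_empty _ _)

theorem IsMatchProd.ra_mul {B : Finset (Fin n)} {x : Rn n} (hx : IsMatchProd B x) {i : Fin n}
    (hi : i ∈ B) : ra i * x = 0 := by
  obtain ⟨k, C, y, hik, -, -, -, -, rfl⟩ := hx.exists_eq_mul hi
  rw [← mul_assoc, ra_mul_rb hik, zero_mul]

/-- The span of the products `b_M` over all perfect matchings `M` of `B`. -/
noncomputable def matchSpan (B : Finset (Fin n)) : Submodule ℚ (Rn n) :=
  Submodule.span ℚ {x | IsMatchProd B x}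

theorem ra_mul_of_mem_matchSpan {B : Finset (Fin n)} {x : Rn n} (hx : x ∈ matchSpan B)
    {i : Fin n} (hi : i ∈ B) : ra i * x = 0 := by
  induction hx using Submodule.span_induction with
  | mem x h => exact h.ra_mul hi
  | zero => rw [mul_zero]
  | add x y _ _ hx hy => rw [mul_add, hx, hy, add_zero]
  | smul c x _ hx => rw [mul_smul_comm, hx, smul_zero]

theorem rb_mul_mem_matchSpan {B : Finset (Fin n)} {x : Rn n} (hx : x ∈ matchSpan B)
    {i j : Fin n} (hij : i ≠ j) (hi : i ∉ B) (hj : j ∉ B) :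
    rb i j * x ∈ matchSpan (insert i (insert j B)) := by
  induction hx using Submodule.span_induction with
  | mem x h => exact Submodule.subset_span (.mul hij hi hj h)
  | zero => rw [mul_zero]; exact zero_mem _
  | add x y _ _ hx hy => rw [mul_add]; exact add_mem hx hy
  | smul c x _ hx => rw [mul_smul_comm]; exact Submodule.smul_mem _ _ hx

/-! ### Contractions and the Casimir identity -/

theorem IsMatchProd.exists_contraction_of_edge {B : Finset (Fin n)} {y : Rn n}
    (hy : IsMatchProd B y) {i k : Fin n} (hik : i ≠ k) (hi : i ∉ B) (hk : k ∉ B) :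
    ∃ Z : Fin n → Rn n,
      (∀ j ∈ B, Z j ∈ matchSpan (insert k (B.erase j)) ∧
        rb i j * (rb i k * y) = ra i * ra j * Z j) ∧
      2 * ∑ j ∈ B, rb i j * Z j = -(B.card : Rn n) * (rb i k * y) := by
  induction hy with
  | one => exact ⟨0, by simp, by simp⟩
  | @mul p q B y hpq hp hq hy ih =>
    simp only [Finset.mem_insert, not_or] at hi hk
    obtain ⟨hip, hiq, hiB⟩ := hi
    obtain ⟨hkp, hkq, hkB⟩ := hk
    obtain ⟨Z, hZ, hsum⟩ := ih hiB hkB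
    have hpqB : p ∉ insert q B := by simp [hpq, hp]
    have hne (j : Fin n) (hj : j ∈ B) : j ≠ p ∧ j ≠ q :=
      ⟨fun h => hp (h ▸ hj), fun h => hq (h ▸ hj)⟩
    refine ⟨fun j => if j = p then rb k q * y else if j = q then rb k p * y else rb p q * Z j,
      fun j hj => ?_, ?_⟩ <;> beta_reduce
    · rw [Finset.mem_insert, Finset.mem_insert] at hj
      by_cases hjp : j = p
      · subst hjp
        rw [if_pos rfl, Finset.erase_insert hpqB]
        refine ⟨Submodule.subset_span (.mul hkq hkB hq hy), ?_⟩
        linear_combination (rb j q * y) * rb_mul_rb hip hik (Ne.symm hkp)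
          + (ra i * y) * rb_mul_rb (Ne.symm hkp) hpq hkq
      by_cases hjq : j = q
      · subst hjq
        rw [if_neg hjp, if_pos rfl, Finset.insert_comm, Finset.erase_insert (by simp [hjp, hq])]
        refine ⟨Submodule.subset_span (.mul hkp hkB hp hy), ?_⟩
        rw [rb_comm p j]
        linear_combination (rb j p * y) * rb_mul_rb hiq hik (Ne.symm hkq)
          + (ra i * y) * rb_mul_rb (Ne.symm hkq) hjp hkp
      have hjB : j ∈ B := by tauto
      rw [if_neg hjp, if_neg hjq]
      refine ⟨?_, ?_⟩
      · have h := rb_mul_mem_matchSpan (hZ j hjB).1 hpq (by simp [hp, Ne.symm hkp])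
          (by simp [hq, Ne.symm hkq])
        convert h using 2
        ext t
        simp only [Finset.mem_insert, Finset.mem_erase]
        have h1 : t = p → t ≠ j := fun h h' => hjp (h' ▸ h)
        have h2 : t = q → t ≠ j := fun h h' => hjq (h' ▸ h)
        tauto
      · linear_combination rb p q * (hZ j hjB).2
    · rw [Finset.sum_insert hpqB, Finset.sum_insert hq, if_pos rfl, if_neg hpq.symm, if_pos rfl,
        Finset.card_insert_of_notMem hpqB, Finset.card_insert_of_notMem hq]
      have hB : ∑ j ∈ B, rb i j *
          (if j = p then rb k q * y else if j = q then rb k p * y else rb p q * Z j)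
          = rb p q * ∑ j ∈ B, rb i j * Z j := by
        rw [Finset.mul_sum]
        refine Finset.sum_congr rfl fun j hj => ?_
        rw [if_neg (hne j hj).1, if_neg (hne j hj).2]
        ring
      rw [hB]
      push_cast
      have h4 := rb_plucker hip hik hiq (Ne.symm hkp) hpq hkq
      rw [rb_comm p k] at h4
      linear_combination rb p q * hsum + 2 * y * h4

theorem exists_contraction {B : Finset (Fin n)} {i : Fin n} (hi : i ∈ B) {x : Rn n}
    (hx : x ∈ matchSpan B) :
    ∃ Y : Fin n → Rn n,
      (∀ j ∈ B.erase i, Y j ∈ matchSpan ((B.erase i).erase j) ∧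
        rb i j * x = ra i * ra j * Y j) ∧
      2 * ∑ j ∈ B.erase i, rb i j * Y j = -((B.card : Rn n) + 2) * x := by
  induction hx using Submodule.span_induction with
  | mem x h =>
    obtain ⟨k, C, y, hik, hiC, hkC, rfl, hy, rfl⟩ := IsMatchProd.exists_eq_mul h hi
    obtain ⟨Z, hZ, hsum⟩ := hy.exists_contraction_of_edge hik hiC hkC
    have hikC : i ∉ insert k C := by simp [hik, hiC]
    rw [Finset.erase_insert hikC]
    refine ⟨fun j => if j = k then -2 * y else Z j, fun j hj => ?_, ?_⟩ <;> beta_reduce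
    · by_cases hjk : j = k
      · subst hjk
        rw [if_pos rfl, Finset.erase_insert hkC]
        refine ⟨?_, by linear_combination y * rb_mul_self hik⟩
        rw [← neg_two_smul]
        exact Submodule.smul_mem _ _ (Submodule.subset_span hy)
      · have hjC : j ∈ C := by simpa [hjk] using hj
        rw [if_neg hjk, Finset.erase_insert_of_ne (Ne.symm hjk)]
        exact hZ j hjC
    · rw [Finset.sum_insert hkC, if_pos rfl, Finset.card_insert_of_notMem hikC,
        Finset.card_insert_of_notMem hkC]
      have hC : ∑ j ∈ C, rb i j * (if j = k then -2 * y else Z j) = ∑ j ∈ C, rb i j * Z j :=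
        Finset.sum_congr rfl fun j hj => by
          rw [if_neg (ne_of_mem_of_not_mem hj hkC)]
      rw [hC]
      push_cast
      linear_combination hsum
  | zero => exact ⟨0, by simp, by simp⟩
  | add x y _ _ hx hy =>
    obtain ⟨Y, hY, hYs⟩ := hx
    obtain ⟨Z, hZ, hZs⟩ := hy
    refine ⟨Y + Z, fun j hj => ⟨add_mem (hY j hj).1 (hZ j hj).1, ?_⟩, ?_⟩
    · rw [Pi.add_apply]
      linear_combination (hY j hj).2 + (hZ j hj).2
    · simp only [Pi.add_apply, mul_add, Finset.sum_add_distrib] at *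
      linear_combination hYs + hZs
  | smul c x _ hx =>
    obtain ⟨Y, hY, hYs⟩ := hx
    refine ⟨c • Y, fun j hj => ⟨Submodule.smul_mem _ _ (hY j hj).1, ?_⟩, ?_⟩
    · rw [Pi.smul_apply, mul_smul_comm, mul_smul_comm, (hY j hj).2]
    · simp only [Pi.smul_apply, mul_smul_comm, ← Finset.smul_sum]
      rw [hYs]

/-- Nondegeneracy of the pairing between products over matchings of a fixed set `B`. -/
theorem eq_zero_of_forall_matchProd {A B : Finset (Fin n)} (hAB : Disjoint A B) {x : Rn n}
    (hx : x ∈ matchSpan B) (h : ∀ y, IsMatchProd B y → raProd A * x * y = 0) : x = 0 := by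
  induction hB : B.card using Nat.strong_induction_on generalizing A B x with
  | _ m ih =>
  rcases B.eq_empty_or_nonempty with rfl | ⟨i, hi⟩
  · have hx' : x ∈ Submodule.span ℚ {(1 : Rn n)} :=
      Submodule.span_mono (fun y hy => IsMatchProd.eq_one hy) hx
    obtain ⟨c, rfl⟩ := Submodule.mem_span_singleton.mp hx'
    have h1 := h 1 .one
    rw [mul_one, mul_smul_comm, mul_one, smul_eq_zero] at h1
    rcases h1 with h1 | h1
    · rw [h1, zero_smul]
    · exact absurd h1 (raProd_ne_zero A)
  · obtain ⟨Y, hY, hsum⟩ := exists_contraction hi hx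
    have hiA : i ∉ A := Finset.disjoint_right.mp hAB hi
    have hY0 : ∀ j ∈ B.erase i, Y j = 0 := by
      intro j hj
      obtain ⟨hji, hjB⟩ := Finset.mem_erase.mp hj
      have hjA : j ∉ A := Finset.disjoint_right.mp hAB hjB
      refine ih ((B.erase i).erase j).card ?_ (A := insert i (insert j A)) ?_ (hY j hj).1 ?_ rfl
      · rw [← hB]
        exact (Finset.card_le_card (Finset.erase_subset _ _)).trans_lt
          (Finset.card_erase_lt_of_mem hi)
      · rw [Finset.disjoint_left]
        intro t ht ht'
        simp only [Finset.mem_insert, Finset.mem_erase] at ht ht'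
        rcases ht with rfl | rfl | ht
        · exact ht'.2.1 rfl
        · exact ht'.1 rfl
        · exact Finset.disjoint_left.mp hAB ht ht'.2.2
      · intro y hy
        have hmul := IsMatchProd.mul (Ne.symm hji) (by simp) (by simp) hy
        rw [Finset.insert_erase hj, Finset.insert_erase hi] at hmul
        rw [raProd_insert (by simp [hiA, Ne.symm hji]), raProd_insert hjA]
        linear_combination h _ hmul - raProd A * y * (hY j hj).2
    rw [Finset.sum_eq_zero fun j hj => by rw [hY0 j hj, mul_zero], mul_zero] at hsum
    have h2 : ((B.card : ℚ) + 2) • x = 0 := by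
      refine (Algebra.smul_def ((B.card : ℚ) + 2) x).trans ?_
      rw [map_add, map_natCast, map_ofNat]
      linear_combination hsum
    rcases smul_eq_zero.mp h2 with h3 | h3
    · exact absurd h3 (by positivity)
    · exact h3

/-! ### Standard monomials span the graded pieces -/

/-- The elements `a_A b_M` of degree `d`, where `M` is a perfect matching of a set disjoint
from `A`. -/
def stdSet (n d : ℕ) : Set (Rn n) :=
  {z | ∃ A B y, Disjoint A B ∧ 2 * A.card + B.card = 2 * d ∧ IsMatchProd B y ∧ z = raProd A * y}

theorem ra_mul_mem_span_stdSet {d : ℕ} (i : Fin n) {z : Rn n} (hz : z ∈ stdSet n d) :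
    ra i * z ∈ Submodule.span ℚ (stdSet n (d + 1)) := by
  obtain ⟨A, B, y, hAB, hd, hy, rfl⟩ := hz
  by_cases hiA : i ∈ A
  · rw [← mul_assoc, ra_mul_raProd_of_mem hiA, zero_mul]
    exact zero_mem _
  by_cases hiB : i ∈ B
  · rw [mul_left_comm, hy.ra_mul hiB, mul_zero]
    exact zero_mem _
  refine Submodule.subset_span ⟨insert i A, B, y, ?_, ?_, hy, ?_⟩
  · rw [Finset.disjoint_insert_left]
    exact ⟨hiB, hAB⟩
  · rw [Finset.card_insert_of_notMem hiA]
    omega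
  · rw [raProd_insert hiA, mul_assoc]

theorem rb_mul_mem_span_stdSet_of_mem {d : ℕ} {i j : Fin n} (hij : i ≠ j)
    {A B : Finset (Fin n)} {y : Rn n} (hAB : Disjoint A B) (hd : 2 * A.card + B.card = 2 * d)
    (hBy : IsMatchProd B y) (hiB : i ∈ B) (hjA : j ∉ A) :
    rb i j * (raProd A * y) ∈ Submodule.span ℚ (stdSet n (d + 1)) := by
  obtain ⟨k, C, y, hik, hiC, hkC, rfl, hy, rfl⟩ := hBy.exists_eq_mul hiB
  simp only [Finset.disjoint_insert_right] at hAB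
  obtain ⟨hiA, hkA, hAC⟩ := hAB
  rw [Finset.card_insert_of_notMem (by simp [hik, hiC]), Finset.card_insert_of_notMem hkC] at hd
  by_cases hjk : j = k
  · subst hjk
    have h : rb i j * (raProd A * (rb i j * y)) =
        (-2 : ℚ) • (raProd (insert i (insert j A)) * y) := by
      rw [neg_two_smul, raProd_insert (by simp [hij, hiA]), raProd_insert hjA]
      linear_combination raProd A * y * rb_mul_self hij
    rw [h]
    refine Submodule.smul_mem _ _ (Submodule.subset_span ⟨_, C, y, ?_, ?_, hy, rfl⟩)
    · simp only [Finset.disjoint_insert_left]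
      exact ⟨hiC, hkC, hAC⟩
    · rw [Finset.card_insert_of_notMem (by simp [hij, hiA]), Finset.card_insert_of_notMem hjA]
      omega
  by_cases hjC : j ∈ C
  · obtain ⟨l, D, z, hjl, hjD, hlD, rfl, hz, rfl⟩ := hy.exists_eq_mul hjC
    simp only [Finset.disjoint_insert_right, Finset.mem_insert, not_or] at hAC hkC hiC
    rw [Finset.card_insert_of_notMem (by simp [hjl, hjD]), Finset.card_insert_of_notMem hlD] at hd
    refine Submodule.subset_span ⟨insert i (insert j A), insert k (insert l D), rb k l * z,
      ?_, ?_, .mul hkC.2.1 hkC.2.2 hlD hz, ?_⟩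
    · simp only [Finset.disjoint_insert_left, Finset.disjoint_insert_right, Finset.mem_insert,
        not_or]
      exact by tauto
    · rw [Finset.card_insert_of_notMem (by simp [hij, hiA]), Finset.card_insert_of_notMem hjA,
        Finset.card_insert_of_notMem (by simp [hkC.2]), Finset.card_insert_of_notMem hlD]
      omega
    · rw [raProd_insert (by simp [hij, hiA]), raProd_insert hjA]
      linear_combination raProd A * rb j l * z * rb_mul_rb hij hik hjk
        + raProd A * ra i * z * rb_mul_rb hjk hjl hkC.2.1
  · refine Submodule.subset_span ⟨insert i A, insert j (insert k C), rb j k * y, ?_, ?_,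
      .mul hjk hjC hkC hy, ?_⟩
    · simp only [Finset.disjoint_insert_left, Finset.disjoint_insert_right, Finset.mem_insert,
        not_or]
      exact ⟨⟨hij.symm, hjA⟩, ⟨hik.symm, hkA⟩, hiC, hAC⟩
    · rw [Finset.card_insert_of_notMem hiA, Finset.card_insert_of_notMem (by simp [hjk, hjC]),
        Finset.card_insert_of_notMem hkC]
      omega
    · rw [raProd_insert hiA]
      linear_combination raProd A * y * rb_mul_rb hij hik hjk

theorem rb_mul_mem_span_stdSet {d : ℕ} {i j : Fin n} (hij : i ≠ j) {z : Rn n}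
    (hz : z ∈ stdSet n d) : rb i j * z ∈ Submodule.span ℚ (stdSet n (d + 1)) := by
  obtain ⟨A, B, y, hAB, hd, hy, rfl⟩ := hz
  by_cases hiA : i ∈ A
  · have h : rb i j * (raProd A * y) = 0 := by
      rw [raProd, ← Finset.mul_prod_erase _ _ hiA]
      linear_combination (∏ x ∈ A.erase i, ra x) * y * ra_mul_rb hij
    rw [h]
    exact zero_mem _
  by_cases hjA : j ∈ A
  · have h : rb i j * (raProd A * y) = 0 := by
      rw [raProd, ← Finset.mul_prod_erase _ _ hjA, rb_comm]
      linear_combination (∏ x ∈ A.erase j, ra x) * y * ra_mul_rb hij.symm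
    rw [h]
    exact zero_mem _
  by_cases hiB : i ∈ B
  · exact rb_mul_mem_span_stdSet_of_mem hij hAB hd hy hiB hjA
  by_cases hjB : j ∈ B
  · rw [rb_comm]
    exact rb_mul_mem_span_stdSet_of_mem hij.symm hAB hd hy hjB hiA
  refine Submodule.subset_span ⟨A, insert i (insert j B), rb i j * y, ?_, ?_,
    .mul hij hiB hjB hy, by ring⟩
  · simp only [Finset.disjoint_insert_right]
    exact ⟨hiA, hjA, hAB⟩
  · rw [Finset.card_insert_of_notMem (by simp [hij, hiB]), Finset.card_insert_of_notMem hjB]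
    omega

theorem mkR_X_mul_mem_span_stdSet {d : ℕ} (v : Fin n ⊕ {s : Sym2 (Fin n) // ¬ s.IsDiag})
    {z : Rn n} (hz : z ∈ Submodule.span ℚ (stdSet n d)) :
    mkR n (X v) * z ∈ Submodule.span ℚ (stdSet n (d + 1)) := by
  induction hz using Submodule.span_induction with
  | mem z hz =>
    rcases v with i | ⟨s, hs⟩
    · exact ra_mul_mem_span_stdSet i hz
    · induction s using Sym2.ind with
      | _ i j =>
        have hij : i ≠ j := by simpa using hs
        have h := rb_mul_mem_span_stdSet hij hz
        rwa [rb, bP, bS, dif_neg hs] at h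
  | zero => rw [mul_zero]; exact zero_mem _
  | add x y _ _ hx hy => rw [mul_add]; exact add_mem hx hy
  | smul c x _ hx => rw [mul_smul_comm]; exact Submodule.smul_mem _ _ hx

theorem mkR_monomial_mem_span_stdSet (d : ℕ) (s : Fin n ⊕ {s : Sym2 (Fin n) // ¬ s.IsDiag} →₀ ℕ)
    (hs : s.degree = d) : mkR n (monomial s 1) ∈ Submodule.span ℚ (stdSet n d) := by
  induction d generalizing s with
  | zero =>
    rw [Finsupp.degree_eq_zero_iff] at hs
    subst hs
    refine Submodule.subset_span ⟨∅, ∅, 1, by simp, by simp, .one, ?_⟩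
    rw [mul_one, raProd, Finset.prod_empty]
    exact map_one _
  | succ d ih =>
    have hs0 : s ≠ 0 := by
      rintro rfl
      simp at hs
    obtain ⟨v, hv⟩ := Finsupp.ne_iff.mp hs0
    have hle : Finsupp.single v 1 ≤ s := by
      rw [Finsupp.single_le_iff]
      exact Nat.one_le_iff_ne_zero.mpr hv
    obtain ⟨t, rfl⟩ := exists_add_of_le hle
    rw [map_add, Finsupp.degree_single] at hs
    have h : (monomial (Finsupp.single v 1 + t) 1 : Pn n) = X v * monomial t 1 := by
      rw [X, monomial_mul, one_mul]
    rw [h, map_mul]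
    exact mkR_X_mul_mem_span_stdSet v (ih t (by omega))

theorem Rgrade_le_span_stdSet (d : ℕ) : Rgrade n d ≤ Submodule.span ℚ (stdSet n d) := by
  rintro _ ⟨p, hp, rfl⟩
  rw [SetLike.mem_coe, mem_homogeneousSubmodule] at hp
  rw [p.as_sum, map_sum]
  refine Submodule.sum_mem _ fun s hs => ?_
  have h : (monomial s (coeff s p) : Pn n) = coeff s p • monomial s 1 := by
    rw [smul_monomial, smul_eq_mul, mul_one]
  rw [h, map_smul]
  refine Submodule.smul_mem _ _ (mkR_monomial_mem_span_stdSet d s ?_)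
  rw [← hp (mem_support_iff.mp hs), Finsupp.degree_eq_weight_one]
  rfl

instance finiteDimensional_Rgrade (d : ℕ) : FiniteDimensional ℚ (Rgrade n d) := by
  have : FiniteDimensional ℚ
      (homogeneousSubmodule (Fin n ⊕ {s : Sym2 (Fin n) // ¬ s.IsDiag}) ℚ d) :=
    Module.Finite.iff_fg.mpr (homogeneousSubmodule_fg _ _ d)
  exact Module.Finite.map _ _

/-! ### Membership in graded pieces -/

theorem one_mem_Rgrade : (1 : Rn n) ∈ Rgrade n 0 :=
  ⟨1, isHomogeneous_one _ _, map_one (mkR n)⟩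

theorem mul_mem_Rgrade {d e : ℕ} {x y : Rn n} (hx : x ∈ Rgrade n d) (hy : y ∈ Rgrade n e) :
    x * y ∈ Rgrade n (d + e) := by
  obtain ⟨p, hp, rfl⟩ := hx
  obtain ⟨q, hq, rfl⟩ := hy
  exact ⟨p * q, IsHomogeneous.mul hp hq, map_mul (mkR n) _ _⟩

theorem ra_mem_Rgrade (i : Fin n) : ra i ∈ Rgrade n 1 :=
  ⟨_, isHomogeneous_X _ _, rfl⟩

theorem rb_mem_Rgrade (i j : Fin n) : rb i j ∈ Rgrade n 1 := by
  refine ⟨bP n i j, ?_, rfl⟩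
  rw [bP, bS]
  split_ifs
  · exact zero_mem _
  · exact isHomogeneous_X _ _

theorem raProd_mem_Rgrade (A : Finset (Fin n)) : raProd A ∈ Rgrade n A.card := by
  induction A using Finset.induction_on with
  | empty => exact one_mem_Rgrade
  | insert i A hi ih =>
    rw [raProd_insert hi, Finset.card_insert_of_notMem hi, add_comm]
    exact mul_mem_Rgrade (ra_mem_Rgrade i) ih

theorem IsMatchProd.mem_Rgrade {B : Finset (Fin n)} {y : Rn n} (hy : IsMatchProd B y) :
    ∃ m, B.card = 2 * m ∧ y ∈ Rgrade n m := by
  induction hy with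
  | one => exact ⟨0, rfl, one_mem_Rgrade⟩
  | @mul i j B x hij hi hj hx ih =>
    obtain ⟨m, hm, hxm⟩ := ih
    refine ⟨1 + m, ?_, mul_mem_Rgrade (rb_mem_Rgrade i j) hxm⟩
    rw [Finset.card_insert_of_notMem (by simp [hij, hi]), Finset.card_insert_of_notMem hj]
    omega

/-! ### The pairing -/

/-- The pairs `(A, B)` of disjoint sets indexing the multidegrees of total degree `d`. -/
def multidegrees (n d : ℕ) : Finset (Finset (Fin n) × Finset (Fin n)) :=
  Finset.univ.filter fun p => Disjoint p.1 p.2 ∧ 2 * p.1.card + p.2.card = 2 * d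

theorem exists_decomposition {d : ℕ} {x : Rn n} (hx : x ∈ Submodule.span ℚ (stdSet n d)) :
    ∃ f : Finset (Fin n) × Finset (Fin n) → Rn n, (∀ p, f p ∈ matchSpan p.2) ∧
      x = ∑ p ∈ multidegrees n d, raProd p.1 * f p := by
  induction hx using Submodule.span_induction with
  | mem z hz =>
    obtain ⟨A, B, y, hAB, hd, hy, rfl⟩ := hz
    refine ⟨fun p => if p = (A, B) then y else 0, fun p => ?_, ?_⟩
    · beta_reduce
      split_ifs with h
      · subst h
        exact Submodule.subset_span hy
      · exact zero_mem _
    · rw [Finset.sum_eq_single (A, B)] <;> beta_reduce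
      · rw [if_pos rfl]
      · intro p _ hp
        rw [if_neg hp, mul_zero]
      · intro h
        exact absurd (by simp [multidegrees, hAB, hd]) h
  | zero => exact ⟨0, fun p => zero_mem _, by simp⟩
  | add x y _ _ hx hy =>
    obtain ⟨f, hf, rfl⟩ := hx
    obtain ⟨g, hg, rfl⟩ := hy
    refine ⟨f + g, fun p => add_mem (hf p) (hg p), ?_⟩
    simp only [Pi.add_apply, mul_add, Finset.sum_add_distrib]
  | smul c x _ hx =>
    obtain ⟨f, hf, rfl⟩ := hx
    refine ⟨c • f, fun p => Submodule.smul_mem _ _ (hf p), ?_⟩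
    simp only [Pi.smul_apply, mul_smul_comm, Finset.smul_sum]

theorem multidegree_cases {d : ℕ} {A B A' B' : Finset (Fin n)} (h : (A, B) ∈ multidegrees n d)
    (h' : (A', B') ∈ multidegrees n d) (hne : (A', B') ≠ (A, B)) :
    ∃ i, (i ∈ A' ∧ i ∉ A) ∨ (i ∈ B' ∧ i ∉ A ∪ B) := by
  by_contra! hcon
  simp only [multidegrees, Finset.mem_filter, Finset.mem_univ, true_and] at h h'
  have hA : A' ⊆ A := fun i hi => (hcon i).1 hi
  have hB : B' ⊆ A ∪ B := fun i hi => (hcon i).2 hi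
  have hU : A' ∪ B' ⊆ A ∪ B := Finset.union_subset (hA.trans Finset.subset_union_left) hB
  have h1 := Finset.card_le_card hA
  have h2 := Finset.card_le_card hU
  have h3 := Finset.card_union_of_disjoint h.1
  have h4 := Finset.card_union_of_disjoint h'.1
  have hAA := Finset.eq_of_subset_of_card_le hA (by omega)
  have hUU := Finset.eq_of_subset_of_card_le hU (by omega)
  subst hAA
  have hBB : B' = B := by
    rw [← Finset.union_sdiff_cancel_left h'.1, hUU, Finset.union_sdiff_cancel_left h.1]
  exact hne (by rw [hBB])

theorem mul_eq_zero_of_multidegree_ne {d : ℕ} {A B A' B' : Finset (Fin n)}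
    (h : (A, B) ∈ multidegrees n d) (h' : (A', B') ∈ multidegrees n d)
    (hne : (A', B') ≠ (A, B)) {x y : Rn n} (hx : x ∈ matchSpan B') (hy : IsMatchProd B y) :
    raProd A' * x * (raProd (A ∪ B)ᶜ * y) = 0 := by
  obtain ⟨i, ⟨hi', hi⟩ | ⟨hi', hi⟩⟩ := multidegree_cases h h' hne
  · rw [raProd, ← Finset.mul_prod_erase _ _ hi']
    by_cases hiB : i ∈ B
    · linear_combination (∏ x ∈ A'.erase i, ra x) * x * raProd (A ∪ B)ᶜ * hy.ra_mul hiB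
    · have hic : i ∈ (A ∪ B)ᶜ := by simp [hi, hiB]
      linear_combination (∏ x ∈ A'.erase i, ra x) * x * y * ra_mul_raProd_of_mem hic
  · have hic : i ∈ (A ∪ B)ᶜ := by simpa using hi
    rw [raProd, raProd, ← Finset.mul_prod_erase _ _ hic]
    linear_combination (∏ x ∈ A', ra x) * (∏ x ∈ (A ∪ B)ᶜ.erase i, ra x) * y *
      ra_mul_of_mem_matchSpan hx hi'

theorem eq_zero_of_forall_mul_eq_zero {d e : ℕ} (hde : d + e = n) {x : Rn n}
    (hx : x ∈ Rgrade n d) (h : ∀ y ∈ Rgrade n e, x * y = 0) : x = 0 := by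
  obtain ⟨f, hf, rfl⟩ := exists_decomposition (Rgrade_le_span_stdSet d hx)
  refine Finset.sum_eq_zero fun p hp => ?_
  obtain ⟨A, B⟩ := p
  have hAB := hp
  simp only [multidegrees, Finset.mem_filter, Finset.mem_univ, true_and] at hAB
  have hcard : (A ∪ B)ᶜ.card + (A.card + B.card) = n := by
    rw [← Finset.card_union_of_disjoint hAB.1, Finset.card_compl_add_card, Fintype.card_fin]
  have hAC : Disjoint A (A ∪ B)ᶜ :=
    disjoint_compl_right.mono_left Finset.subset_union_left
  have hCB : Disjoint (A ∪ B)ᶜ B :=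
    (disjoint_compl_right.mono_left Finset.subset_union_right).symm
  rw [eq_zero_of_forall_matchProd (A := A ∪ (A ∪ B)ᶜ)
    (Finset.disjoint_union_left.mpr ⟨hAB.1, hCB⟩) (hf (A, B)), mul_zero]
  intro y hy
  obtain ⟨m, hm, hym⟩ := hy.mem_Rgrade
  have hmem := mul_mem_Rgrade (raProd_mem_Rgrade (A ∪ B)ᶜ) hym
  rw [show (A ∪ B)ᶜ.card + m = e by omega] at hmem
  have h0 := h _ hmem
  rw [Finset.sum_mul, Finset.sum_eq_single (A, B)
    (fun q hq hne => mul_eq_zero_of_multidegree_ne hp hq hne (hf q) hy)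
    (absurd hp)] at h0
  have hprod : raProd (A ∪ (A ∪ B)ᶜ) = raProd A * raProd (A ∪ B)ᶜ := Finset.prod_union hAC
  rw [hprod]
  linear_combination h0

end Ring

/-- For every `0 ≤ d ≤ n`, the multiplication map
`R_n^d × R_n^{n-d} → R_n^n` is a perfect pairing of finite-dimensional
ℚ-vector spaces. -/
theorem perfect_pairing (n : ℕ) (hn : 1 ≤ n) (d : ℕ) (hd : d ≤ n) :
    FiniteDimensional ℚ (Rgrade n d) ∧
    FiniteDimensional ℚ (Rgrade n (n - d)) ∧
    (∀ x ∈ Rgrade n d, (∀ y ∈ Rgrade n (n - d), x * y = 0) → x = 0) ∧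
    (∀ y ∈ Rgrade n (n - d), (∀ x ∈ Rgrade n d, x * y = 0) → y = 0) := by
  refine ⟨inferInstance, inferInstance, fun x hx h => ?_, fun y hy h => ?_⟩
  · exact eq_zero_of_forall_mul_eq_zero (Nat.add_sub_of_le hd) hx h
  · refine eq_zero_of_forall_mul_eq_zero (Nat.sub_add_cancel hd) hy fun x hx => ?_
    rw [mul_comm]
    exact h x hx

end TautCt
end

section
/- Let v ∈ R_n^d and w ∈ R_n^{n−d} be standard monomials. If the product v·w is nonzero in R_n^n, then B_v = B_w, and the set {1,…,n} is the disjoint union of A_v, A_w and B_v. -/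
open MvPolynomial

namespace TautCt

theorem mkR_eq_zero_of_dvd {n : ℕ} {r p : Pn n} (hr : r ∈ relSet n) (h : r ∣ p) :
    mkR n p = 0 :=
  Ideal.Quotient.eq_zero_iff_mem.mpr (Ideal.mem_of_dvd _ h (Ideal.subset_span hr))

theorem aP_dvd_stdMon {n : ℕ} {A : Finset (Fin n)} (M : Finset (Sym2 (Fin n))) {i : Fin n}
    (hi : i ∈ A) : aP n i ∣ stdMon n A M :=
  (Finset.dvd_prod_of_mem _ hi).mul_right _

theorem IsMatching.exists_bP_dvd_stdMon {n : ℕ} {B : Finset (Fin n)}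
    {M : Finset (Sym2 (Fin n))} (hM : IsMatching n B M) (A : Finset (Fin n)) {i : Fin n}
    (hi : i ∈ B) : ∃ j, i ≠ j ∧ bP n i j ∣ stdMon n A M := by
  obtain ⟨s, hs, j, rfl⟩ := (hM.2.2 i).mp hi
  exact ⟨j, fun h => hM.1 _ hs (Sym2.mk_isDiag_iff.mpr h),
    (Finset.dvd_prod_of_mem (bS n) hs).mul_left _⟩

theorem disjoint_of_mkR_stdMon_mul_ne_zero {n : ℕ} {A A' : Finset (Fin n)}
    {M M' : Finset (Sym2 (Fin n))}
    (hne : mkR n (stdMon n A M) * mkR n (stdMon n A' M') ≠ 0) : Disjoint A A' := by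
  refine Finset.disjoint_left.mpr fun i hi hi' => hne ?_
  rw [← map_mul]
  refine mkR_eq_zero_of_dvd (r := aP n i ^ 2) (Or.inl ⟨i, rfl⟩) ?_
  rw [sq]
  exact mul_dvd_mul (aP_dvd_stdMon M hi) (aP_dvd_stdMon M' hi')

theorem IsMatching.disjoint_of_mkR_stdMon_mul_ne_zero {n : ℕ} {A A' B' : Finset (Fin n)}
    {M M' : Finset (Sym2 (Fin n))} (hM' : IsMatching n B' M')
    (hne : mkR n (stdMon n A M) * mkR n (stdMon n A' M') ≠ 0) : Disjoint A B' := by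
  refine Finset.disjoint_left.mpr fun i hi hi' => hne ?_
  obtain ⟨j, hij, hdvd⟩ := hM'.exists_bP_dvd_stdMon A' hi'
  rw [← map_mul]
  exact mkR_eq_zero_of_dvd (Or.inr (Or.inl ⟨i, j, hij, rfl⟩))
    (mul_dvd_mul (aP_dvd_stdMon M hi) hdvd)

/-- If `v ∈ R_n^d` and `w ∈ R_n^{n-d}` are standard monomials with
`v·w ≠ 0` in `R_n^n`, then `B_v = B_w` and `{1,…,n}` is the disjoint union of
`A_v`, `A_w` and `B_v`. -/
theorem standard_monomial_product_nonzero (n : ℕ) (hn : 1 ≤ n) (d : ℕ) (hd : d ≤ n)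
    (Av Bv Aw Bw : Finset (Fin n)) (Mv Mw : Finset (Sym2 (Fin n)))
    (hABv : Disjoint Av Bv) (hMv : IsMatching n Bv Mv)
    (hdv : Av.card + Bv.card / 2 = d)
    (hABw : Disjoint Aw Bw) (hMw : IsMatching n Bw Mw)
    (hdw : Aw.card + Bw.card / 2 = n - d)
    (hne : mkR n (stdMon n Av Mv) * mkR n (stdMon n Aw Mw) ≠ 0) :
    Bv = Bw ∧ Disjoint Av Aw ∧ Disjoint Av Bv ∧ Disjoint Aw Bv ∧
      Av ∪ Aw ∪ Bv = Finset.univ := by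
  have hAA := disjoint_of_mkR_stdMon_mul_ne_zero hne
  have hvw := hMw.disjoint_of_mkR_stdMon_mul_ne_zero hne
  have hwv := hMv.disjoint_of_mkR_stdMon_mul_ne_zero (mul_comm (mkR n (stdMon n Av Mv)) _ ▸ hne)
  have hdisj : Disjoint (Av ∪ Aw) (Bv ∪ Bw) := by
    simp only [Finset.disjoint_union_left, Finset.disjoint_union_right]
    exact ⟨⟨hABv, hwv⟩, hvw, hABw⟩
  have hcard := Finset.card_union_of_disjoint hdisj
  rw [Finset.card_union_of_disjoint hAA] at hcard
  have hle := Finset.card_le_univ ((Av ∪ Aw) ∪ (Bv ∪ Bw))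
  rw [Fintype.card_fin] at hle
  have hBv := Finset.card_le_card (Finset.subset_union_left (s₁ := Bv) (s₂ := Bw))
  have hBw := Finset.card_le_card (Finset.subset_union_right (s₁ := Bv) (s₂ := Bw))
  have hv : Bv = Bv ∪ Bw := Finset.eq_of_subset_of_card_le Finset.subset_union_left (by omega)
  have hw : Bw = Bv ∪ Bw := Finset.eq_of_subset_of_card_le Finset.subset_union_right (by omega)
  refine ⟨hv.trans hw.symm, hAA, hABv, hwv, ?_⟩
  rw [hv, ← Finset.card_eq_iff_eq_univ, Fintype.card_fin]
  omega

end TautCt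
end

section
/- Let m ≥ 2 and let S be the set of degree-m monomials b_{i_1,j_1}⋯b_{i_m,j_m} of R_{2m} corresponding to the perfect matchings of {1,…,2m}. Identify R_{2m}^{2m} with Q via its basis element a_1⋯a_{2m}, so the Gram matrix (v·w)_{v,w ∈ S} has rational entries. Then the kernel of this Gram matrix (i.e., the space of formal Q-linear combinations Σ_{v ∈ S} c_v·v in the free vector space on S such that Σ_v c_v·(v·w) = 0 for all w ∈ S) equals the Q-span of the formal elements (b_{i,j}·b_{k,l} + b_{i,k}·b_{j,l} + b_{i,l}·b_{j,k})·∏_{{p,q} ∈ M'} b_{p,q}, where {i,j,k,l} ranges over 4-element subsets of {1,…,2m} and M' ranges over perfect matchings of {1,…,2m} ∖ {i,j,k,l}. -/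
open MvPolynomial

namespace TautCt

section Exterior

variable {V : Type*} [AddCommGroup V] [Module ℚ V]

theorem ι_mul_ι_mem_center_s4 (x y : V) :
    ExteriorAlgebra.ι ℚ x * ExteriorAlgebra.ι ℚ y ∈
      Subalgebra.center ℚ (ExteriorAlgebra ℚ V) := by
  have swap (u v : V) : ExteriorAlgebra.ι ℚ u * ExteriorAlgebra.ι ℚ v =
      -(ExteriorAlgebra.ι ℚ v * ExteriorAlgebra.ι ℚ u) :=
    eq_neg_of_add_eq_zero_left (ExteriorAlgebra.ι_add_mul_swap u v)
  rw [Subalgebra.mem_center_iff]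
  intro b
  induction b using ExteriorAlgebra.induction with
  | algebraMap r => exact Algebra.commutes r _
  | ι z => rw [← mul_assoc, swap z x, neg_mul, mul_assoc, swap z y, mul_neg, neg_neg, mul_assoc]
  | mul a b ha hb => rw [mul_assoc, hb, ← mul_assoc, ha, mul_assoc]
  | add a b ha hb => rw [add_mul, mul_add, ha, hb]

/-- The product of two vectors, as an element of the center of the exterior algebra. -/
noncomputable def wedge (x y : V) : Subalgebra.center ℚ (ExteriorAlgebra ℚ V) :=
  ⟨ExteriorAlgebra.ι ℚ x * ExteriorAlgebra.ι ℚ y, ι_mul_ι_mem_center_s4 x y⟩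

theorem wedge_self (x : V) : wedge x x = 0 :=
  Subtype.ext (ExteriorAlgebra.ι_sq_zero x)

theorem wedge_swap (x y : V) : wedge x y = -wedge y x :=
  Subtype.ext (eq_neg_of_add_eq_zero_left (ExteriorAlgebra.ι_add_mul_swap x y))

theorem wedge_mul_wedge_exchange (x y z w : V) :
    wedge x y * wedge z w = -(wedge x z * wedge y w) := by
  have swap : ExteriorAlgebra.ι ℚ y * ExteriorAlgebra.ι ℚ z =
      -(ExteriorAlgebra.ι ℚ z * ExteriorAlgebra.ι ℚ y) :=
    eq_neg_of_add_eq_zero_left (ExteriorAlgebra.ι_add_mul_swap y z)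
  refine Subtype.ext ?_
  change ExteriorAlgebra.ι ℚ x * ExteriorAlgebra.ι ℚ y *
      (ExteriorAlgebra.ι ℚ z * ExteriorAlgebra.ι ℚ w) =
    -(ExteriorAlgebra.ι ℚ x * ExteriorAlgebra.ι ℚ z *
      (ExteriorAlgebra.ι ℚ y * ExteriorAlgebra.ι ℚ w))
  rw [mul_assoc, ← mul_assoc (ExteriorAlgebra.ι ℚ y), swap]
  simp only [neg_mul, mul_neg, mul_assoc]

theorem contractLeft_wedge_mul (d : Module.Dual ℚ V) (x y : V) (r : ExteriorAlgebra ℚ V)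
    (hr : CliffordAlgebra.contractLeft d r = 0) :
    CliffordAlgebra.contractLeft d ((wedge x y : ExteriorAlgebra ℚ V) * r) =
      d x • (ExteriorAlgebra.ι ℚ y * r) - d y • (ExteriorAlgebra.ι ℚ x * r) := by
  have key (u : V) (t : ExteriorAlgebra ℚ V) :
      CliffordAlgebra.contractLeft d (ExteriorAlgebra.ι ℚ u * t) =
        d u • t - ExteriorAlgebra.ι ℚ u * CliffordAlgebra.contractLeft d t :=
    CliffordAlgebra.contractLeft_ι_mul d u t
  change CliffordAlgebra.contractLeft d
    (ExteriorAlgebra.ι ℚ x * ExteriorAlgebra.ι ℚ y * r) = _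
  rw [mul_assoc, key, key, hr, mul_zero, sub_zero, mul_smul_comm]

end Exterior

section Model

variable {n : ℕ}

/-- The basis vectors of the first half of `ℚ^n ⊕ ℚ^n`. -/
noncomputable def vecα (i : Fin n) : Fin n ⊕ Fin n → ℚ := Pi.single (Sum.inl i) 1

/-- The basis vectors of the second half of `ℚ^n ⊕ ℚ^n`. -/
noncomputable def vecβ (i : Fin n) : Fin n ⊕ Fin n → ℚ := Pi.single (Sum.inr i) 1

theorem contractLeft_prod_wedge (d : Module.Dual ℚ (Fin n ⊕ Fin n → ℚ)) (s : Finset (Fin n))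
    (hd : ∀ i ∈ s, d (vecα i) = 0 ∧ d (vecβ i) = 0) :
    CliffordAlgebra.contractLeft d
      ((∏ i ∈ s, wedge (vecα i) (vecβ i) : Subalgebra.center ℚ _) :
        ExteriorAlgebra ℚ (Fin n ⊕ Fin n → ℚ)) = 0 := by
  induction s using Finset.induction_on with
  | empty =>
    rw [Finset.prod_empty]
    exact CliffordAlgebra.contractLeft_one (0 : QuadraticForm ℚ (Fin n ⊕ Fin n → ℚ)) d
  | insert i s hi ih =>
    rw [Finset.prod_insert hi, MulMemClass.coe_mul,
      contractLeft_wedge_mul _ _ _ _ (ih fun j hj => hd j (Finset.mem_insert_of_mem hj)),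
      (hd i (Finset.mem_insert_self i s)).1, (hd i (Finset.mem_insert_self i s)).2]
    simp

theorem prod_wedge_ne_zero (s : Finset (Fin n)) :
    (∏ i ∈ s, wedge (vecα i) (vecβ i) :
      Subalgebra.center ℚ (ExteriorAlgebra ℚ (Fin n ⊕ Fin n → ℚ))) ≠ 0 := by
  induction s using Finset.induction_on with
  | empty =>
    rw [Finset.prod_empty]
    exact one_ne_zero
  | insert i s hi ih =>
    intro h
    apply ih
    rw [Finset.prod_insert hi] at h
    have hne (j) (hj : j ∈ s) : j ≠ i := fun e => hi (e ▸ hj)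
    set r := ((∏ i ∈ s, wedge (vecα i) (vecβ i) : Subalgebra.center ℚ _) :
        ExteriorAlgebra ℚ (Fin n ⊕ Fin n → ℚ)) with hrdef
    have h0 : (wedge (vecα i) (vecβ i) : ExteriorAlgebra ℚ (Fin n ⊕ Fin n → ℚ)) * r = 0 :=
      congrArg Subtype.val h
    have h1 : ExteriorAlgebra.ι ℚ (vecβ i) * r = 0 := by
      have := contractLeft_wedge_mul (LinearMap.proj (Sum.inl i)) (vecα i) (vecβ i) r
        (contractLeft_prod_wedge _ s fun j hj => by simp [vecα, vecβ, (hne j hj).symm])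
      rw [h0] at this
      simpa [vecα, vecβ] using this.symm
    have h2 : CliffordAlgebra.contractLeft (LinearMap.proj (Sum.inr i))
        (ExteriorAlgebra.ι ℚ (vecβ i) * r) = r := by
      refine (CliffordAlgebra.contractLeft_ι_mul _ _ _).trans ?_
      rw [contractLeft_prod_wedge _ s fun j hj => by simp [vecα, vecβ, (hne j hj).symm]]
      simp [vecβ]
    refine Subtype.ext ?_
    rw [h1, map_zero] at h2
    exact h2.symm

/-- The evaluation `a_i ↦ w(α_i, β_i)`, `b_{j,k} ↦ -(w(α_j, β_k) + w(α_k, β_j))` attached to a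
bilinear symbol `w` on the basis `α_i = inl i`, `β_i = inr i`. -/
noncomputable def modelHom {Z : Type*} [CommRing Z] [Algebra ℚ Z]
    (w : Fin n ⊕ Fin n → Fin n ⊕ Fin n → Z) : Pn n →ₐ[ℚ] Z :=
  aeval (Sum.elim (fun i => w (.inl i) (.inr i)) fun s =>
    Sym2.lift ⟨fun i j => -(w (.inl i) (.inr j) + w (.inl j) (.inr i)),
      fun _ _ => congrArg Neg.neg (add_comm _ _)⟩ s.1)

section ModelHom

variable {Z : Type*} [CommRing Z] [Algebra ℚ Z] (w : Fin n ⊕ Fin n → Fin n ⊕ Fin n → Z)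

theorem modelHom_aP (i : Fin n) : modelHom w (aP n i) = w (.inl i) (.inr i) := by
  simp [modelHom, aP]

theorem modelHom_bP {i j : Fin n} (h : i ≠ j) :
    modelHom w (bP n i j) = -(w (.inl i) (.inr j) + w (.inl j) (.inr i)) := by
  simp [modelHom, bP, bS, h]

theorem modelHom_eq_zero_of_mem_relSet (hself : ∀ x, w x x = 0) (hswap : ∀ x y, w x y = -w y x)
    (hex : ∀ x y z t, w x y * w z t = -(w x z * w y t)) {x : Pn n} (hx : x ∈ relSet n) :
    modelHom w x = 0 := by
  rcases hx with ⟨i, rfl⟩ | ⟨i, j, hij, rfl⟩ | ⟨i, j, hij, rfl⟩ | ⟨i, j, k, hij, hik, hjk, rfl⟩ |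
    ⟨i, j, k, l, hij, hik, hil, hjk, hjl, hkl, rfl⟩
  · rw [map_pow, modelHom_aP w]
    have h := hex (.inl i) (.inr i) (.inl i) (.inr i)
    rw [hself] at h
    linear_combination h
  · rw [map_mul, modelHom_aP w, modelHom_bP w hij]
    have h1 := hex (.inl i) (.inr i) (.inl i) (.inr j)
    have h2 := hex (.inl i) (.inr i) (.inl j) (.inr i)
    rw [hself] at h1 h2
    linear_combination -h1 - h2
  · simp only [map_add, map_pow, map_mul, map_ofNat, modelHom_aP w, modelHom_bP w hij]
    have s1 := hswap (.inl j) (.inr i)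
    have h1 := hex (.inl i) (.inr j) (.inl i) (.inr j)
    have h2 := hex (.inl j) (.inr i) (.inl j) (.inr i)
    have h3 := hex (.inl i) (.inr j) (.inr i) (.inl j)
    have s3 := hswap (.inr j) (.inl j)
    rw [hself] at h1 h2
    linear_combination h1 + h2 + 2 * w (.inl i) (.inr j) * s1 - 2 * h3
      + 2 * w (.inl i) (.inr i) * s3
  · simp only [map_sub, map_mul, modelHom_aP w, modelHom_bP w hij, modelHom_bP w hik, modelHom_bP w hjk]
    have h1 := hex (.inl i) (.inr j) (.inl i) (.inr k)
    have h2 := hex (.inl j) (.inr i) (.inl k) (.inr i)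
    have h3 := hex (.inl i) (.inr j) (.inr i) (.inl k)
    have h4 := hex (.inl i) (.inr k) (.inr i) (.inl j)
    have h5 := hex (.inr i) (.inl j) (.inr i) (.inl k)
    have s1 := hswap (.inl k) (.inr i)
    have s2 := hswap (.inl j) (.inr i)
    have s3 := hswap (.inr j) (.inl k)
    have s4 := hswap (.inr k) (.inl j)
    rw [hself] at h1 h5
    rw [s1, s2]
    linear_combination h1 + h5 - h3 - h4 + w (.inl i) (.inr i) * (s3 + s4)
  · simp only [map_add, map_mul, modelHom_bP w hij, modelHom_bP w hik, modelHom_bP w hil, modelHom_bP w hjk,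
      modelHom_bP w hjl, modelHom_bP w hkl]
    have h (a b c d : Fin n) : w (.inl a) (.inr b) * w (.inl c) (.inr d) =
        -(w (.inl a) (.inr d) * w (.inl c) (.inr b)) := by
      have h1 := hex (.inl a) (.inr b) (.inl c) (.inr d)
      have h2 := hex (.inl a) (.inr d) (.inl c) (.inr b)
      have h3 := hswap (.inr b) (.inr d)
      linear_combination h1 + h2 - w (.inl a) (.inl c) * h3
    linear_combination h i j k l + h i j l k + h j i k l + h j i l k + h i k j l + h k i l j

end ModelHom

theorem prod_aP_ne_zero (n : ℕ) : mkR n (∏ i, aP n i) ≠ 0 := by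
  intro h
  let w (x y : Fin n ⊕ Fin n) : Subalgebra.center ℚ (ExteriorAlgebra ℚ (Fin n ⊕ Fin n → ℚ)) :=
    wedge (Pi.single x 1) (Pi.single y 1)
  have hmem : (∏ i, aP n i) ∈ relIdeal n := Ideal.Quotient.eq_zero_iff_mem.1 h
  have hle : relIdeal n ≤ RingHom.ker (modelHom w) := Ideal.span_le.2 fun x hx =>
    modelHom_eq_zero_of_mem_relSet w (fun _ => wedge_self _) (fun _ _ => wedge_swap _ _)
      (fun _ _ _ _ => wedge_mul_wedge_exchange _ _ _ _) hx
  have h0 := hle hmem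
  rw [RingHom.mem_ker, map_prod] at h0
  simp only [modelHom_aP] at h0
  exact prod_wedge_ne_zero _ h0

end Model

section Matching

variable {n : ℕ} {B : Finset (Fin n)} {v : Finset (Sym2 (Fin n))}

theorem IsMatching.eq_of_mem (hv : IsMatching n B v) {s t : Sym2 (Fin n)} (hs : s ∈ v)
    (ht : t ∈ v) {a : Fin n} (has : a ∈ s) (hat : a ∈ t) : s = t := by
  by_contra h
  exact hv.2.1 s hs t ht h a has hat

theorem IsMatching.eq_right (hv : IsMatching n B v) {x y z : Fin n} (hy : s(x, y) ∈ v)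
    (hz : s(x, z) ∈ v) : y = z :=
  Sym2.congr_right.1
    (hv.eq_of_mem hy hz (Sym2.mem_mk_left x y) (Sym2.mem_mk_left x z))

theorem IsMatching.ne (hv : IsMatching n B v) {x y : Fin n} (h : s(x, y) ∈ v) : x ≠ y :=
  fun e => hv.1 _ h (Sym2.mk_isDiag_iff.2 e)

theorem IsMatching.left_mem (hv : IsMatching n B v) {x y : Fin n} (h : s(x, y) ∈ v) : x ∈ B :=
  (hv.2.2 x).2 ⟨_, h, Sym2.mem_mk_left x y⟩

theorem IsMatching.right_mem (hv : IsMatching n B v) {x y : Fin n} (h : s(x, y) ∈ v) : y ∈ B :=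
  (hv.2.2 y).2 ⟨_, h, Sym2.mem_mk_right x y⟩

theorem IsMatching.notMem_left (hv : IsMatching n B v) {x : Fin n} (h : x ∉ B) (y : Fin n) :
    s(x, y) ∉ v :=
  fun h' => h (hv.left_mem h')

theorem IsMatching.erase (hv : IsMatching n B v) {x y : Fin n} (h : s(x, y) ∈ v) :
    IsMatching n (B \ {x, y}) (v.erase s(x, y)) := by
  refine ⟨fun s hs => hv.1 s (Finset.mem_of_mem_erase hs), fun s hs t ht =>
    hv.2.1 s (Finset.mem_of_mem_erase hs) t (Finset.mem_of_mem_erase ht), fun a => ?_⟩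
  simp only [Finset.mem_sdiff, Finset.mem_insert, Finset.mem_singleton, Finset.mem_erase]
  constructor
  · rintro ⟨ha, hxy⟩
    obtain ⟨s, hs, has⟩ := (hv.2.2 a).1 ha
    refine ⟨s, ⟨?_, hs⟩, has⟩
    rintro rfl
    exact hxy (Sym2.mem_iff.1 has)
  · rintro ⟨s, ⟨hne, hs⟩, has⟩
    exact ⟨(hv.2.2 a).2 ⟨s, hs, has⟩, fun hxy =>
      hne (hv.eq_of_mem hs h has (Sym2.mem_iff.2 hxy))⟩

theorem IsMatching.insert {B' : Finset (Fin n)} (hv : IsMatching n B v) {x y : Fin n}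
    (hxy : x ≠ y) (hx : x ∉ B) (hy : y ∉ B) (hB : ∀ a, a ∈ B' ↔ a = x ∨ a = y ∨ a ∈ B) :
    IsMatching n B' (insert s(x, y) v) := by
  have disj (t) (ht : t ∈ v) (a : Fin n) (ha : a ∈ s(x, y)) : a ∉ t := by
    intro hat
    have haB := (hv.2.2 a).2 ⟨t, ht, hat⟩
    rcases Sym2.mem_iff.1 ha with rfl | rfl
    exacts [hx haB, hy haB]
  refine ⟨?_, ?_, fun a => ?_⟩
  · rintro s hs
    rcases Finset.mem_insert.1 hs with rfl | hs
    · exact fun h => hxy (Sym2.mk_isDiag_iff.1 h)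
    · exact hv.1 s hs
  · rintro s hs t ht hst a has hat
    rcases Finset.mem_insert.1 hs with rfl | hs <;> rcases Finset.mem_insert.1 ht with rfl | ht
    · exact hst rfl
    · exact disj t ht a has hat
    · exact disj s hs a hat has
    · exact hv.2.1 s hs t ht hst a has hat
  · rw [hB, hv.2.2, Finset.exists_mem_insert, Sym2.mem_iff, or_assoc]

/-- The vertex matched with `x` in `v` (and `x` itself if there is none). -/
noncomputable def partner (v : Finset (Sym2 (Fin n))) (x : Fin n) : Fin n :=
  open Classical in if h : ∃ y, s(x, y) ∈ v then h.choose else x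

theorem IsMatching.mk_partner_mem (hv : IsMatching n B v) {x : Fin n} (hx : x ∈ B) :
    s(x, partner v x) ∈ v := by
  have h : ∃ y, s(x, y) ∈ v := by
    obtain ⟨s, hs, hxs⟩ := (hv.2.2 x).1 hx
    obtain ⟨y, rfl⟩ := hxs
    exact ⟨y, hs⟩
  rw [partner, dif_pos h]
  exact h.choose_spec

theorem IsMatching.partner_eq (hv : IsMatching n B v) {x y : Fin n} (h : s(x, y) ∈ v) :
    partner v x = y :=
  hv.eq_right (hv.mk_partner_mem (hv.left_mem h)) h

theorem IsMatching.partner_mem (hv : IsMatching n B v) {x : Fin n} (hx : x ∈ B) :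
    partner v x ∈ B :=
  hv.right_mem (hv.mk_partner_mem hx)

theorem IsMatching.partner_partner (hv : IsMatching n B v) {x : Fin n} (hx : x ∈ B) :
    partner v (partner v x) = x :=
  hv.partner_eq (by rw [Sym2.eq_swap]; exact hv.mk_partner_mem hx)

theorem isMatching_empty : IsMatching n ∅ v ↔ v = ∅ := by
  constructor
  · intro hv
    refine Finset.eq_empty_of_forall_notMem fun s hs => ?_
    induction s using Sym2.ind with
    | _ x y => exact Finset.notMem_empty x (hv.left_mem hs)
  · rintro rfl
    simp [IsMatching]

end Matching

section Relations

variable {n : ℕ}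

theorem mkR_bP_sq {i j : Fin n} (h : i ≠ j) :
    mkR n (bP n i j) * mkR n (bP n i j) = -2 * (mkR n (aP n i) * mkR n (aP n j)) := by
  have := mkR_eq_zero (n := n) (Or.inr (Or.inr (Or.inl ⟨i, j, h, rfl⟩)))
  simp only [map_add, map_pow, map_mul, map_ofNat] at this
  linear_combination this

theorem mkR_bP_mul_bP {i j k : Fin n} (hij : i ≠ j) (hik : i ≠ k) (hjk : j ≠ k) :
    mkR n (bP n i j) * mkR n (bP n i k) = mkR n (aP n i) * mkR n (bP n j k) := by
  have := mkR_eq_zero (n := n) (Or.inr (Or.inr (Or.inr (Or.inl ⟨i, j, k, hij, hik, hjk, rfl⟩))))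
  simp only [map_sub, map_mul] at this
  linear_combination this

theorem mkR_bP_four_term {i j k l : Fin n} (hij : i ≠ j) (hik : i ≠ k) (hil : i ≠ l)
    (hjk : j ≠ k) (hjl : j ≠ l) (hkl : k ≠ l) :
    mkR n (bP n i j) * mkR n (bP n k l) + mkR n (bP n i k) * mkR n (bP n j l) +
      mkR n (bP n i l) * mkR n (bP n j k) = 0 := by
  have := mkR_eq_zero (n := n)
    (Or.inr (Or.inr (Or.inr (Or.inr ⟨i, j, k, l, hij, hik, hil, hjk, hjl, hkl, rfl⟩))))
  simpa only [map_add, map_mul] using this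

/-- The class in `R_n` of the monomial `∏ b_s`, `s ∈ v`. -/
noncomputable def monR (v : Finset (Sym2 (Fin n))) : Rn n := mkR n (stdMon n ∅ v)

theorem monR_empty : monR (∅ : Finset (Sym2 (Fin n))) = 1 := by
  simp [monR, stdMon]

theorem monR_insert {v : Finset (Sym2 (Fin n))} {x y : Fin n} (h : s(x, y) ∉ v) :
    monR (insert s(x, y) v) = mkR n (bP n x y) * monR v := by
  simp [monR, stdMon, Finset.prod_insert h, bP]

theorem monR_erase {v : Finset (Sym2 (Fin n))} {x y : Fin n} (h : s(x, y) ∈ v) :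
    monR v = mkR n (bP n x y) * monR (v.erase s(x, y)) := by
  rw [← monR_insert (Finset.notMem_erase _ _), Finset.insert_erase h]

/-- The linear extension of `monR` to formal combinations. -/
noncomputable def evalR (n : ℕ) : (Finset (Sym2 (Fin n)) →₀ ℚ) →ₗ[ℚ] Rn n :=
  Finsupp.linearCombination ℚ monR

theorem evalR_single (v : Finset (Sym2 (Fin n))) (q : ℚ) :
    evalR n (Finsupp.single v q) = q • monR v :=
  Finsupp.linearCombination_single ℚ q v

/-- Formal combinations of perfect matchings of `B`. -/
noncomputable def matchings (B : Finset (Fin n)) : Submodule ℚ (Finset (Sym2 (Fin n)) →₀ ℚ) :=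
  Finsupp.supported ℚ ℚ {M | IsMatching n B M}

theorem single_mem_matchings {B : Finset (Fin n)} {v : Finset (Sym2 (Fin n))}
    (hv : IsMatching n B v) (q : ℚ) : Finsupp.single v q ∈ matchings B :=
  Finsupp.single_mem_supported ℚ q hv

/-- The formal four-term element. -/
noncomputable def fourTerm (i j k l : Fin n) (M : Finset (Sym2 (Fin n))) :
    Finset (Sym2 (Fin n)) →₀ ℚ :=
  Finsupp.single (insert s(i, j) (insert s(k, l) M)) 1
    + Finsupp.single (insert s(i, k) (insert s(j, l) M)) 1
    + Finsupp.single (insert s(i, l) (insert s(j, k) M)) 1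

/-- The span of the four-term elements on the vertex set `B`. -/
noncomputable def fourTermSpan (B : Finset (Fin n)) :
    Submodule ℚ (Finset (Sym2 (Fin n)) →₀ ℚ) :=
  Submodule.span ℚ {e | ∃ (i j k l : Fin n) (M : Finset (Sym2 (Fin n))),
    (i ∈ B ∧ j ∈ B ∧ k ∈ B ∧ l ∈ B) ∧
    (i ≠ j ∧ i ≠ k ∧ i ≠ l ∧ j ≠ k ∧ j ≠ l ∧ k ≠ l) ∧
    IsMatching n (B \ {i, j, k, l}) M ∧ e = fourTerm i j k l M}

theorem insert_insert_isMatching {B : Finset (Fin n)} {i j k l : Fin n}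
    {M : Finset (Sym2 (Fin n))} (hB : i ∈ B ∧ j ∈ B ∧ k ∈ B ∧ l ∈ B)
    (hne : i ≠ j ∧ i ≠ k ∧ i ≠ l ∧ j ≠ k ∧ j ≠ l ∧ k ≠ l)
    (hM : IsMatching n (B \ {i, j, k, l}) M) :
    IsMatching n B (insert s(i, j) (insert s(k, l) M)) ∧
      monR (insert s(i, j) (insert s(k, l) M)) =
        mkR n (bP n i j) * mkR n (bP n k l) * monR M := by
  have h1 : IsMatching n (B \ {i, j}) (insert s(k, l) M) :=
    hM.insert hne.2.2.2.2.2 (by simp) (by simp) fun a => by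
      simp only [Finset.mem_sdiff, Finset.mem_insert, Finset.mem_singleton]
      grind
  refine ⟨h1.insert hne.1 (by simp) (by simp) fun a => by
    simp only [Finset.mem_sdiff, Finset.mem_insert, Finset.mem_singleton]
    grind, ?_⟩
  rw [monR_insert (h1.notMem_left (by simp) j), monR_insert (hM.notMem_left (by simp) l), mul_assoc]

theorem fourTerm_mem {B : Finset (Fin n)} {i j k l : Fin n}
    {M : Finset (Sym2 (Fin n))} (hB : i ∈ B ∧ j ∈ B ∧ k ∈ B ∧ l ∈ B)
    (hne : i ≠ j ∧ i ≠ k ∧ i ≠ l ∧ j ≠ k ∧ j ≠ l ∧ k ≠ l)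
    (hM : IsMatching n (B \ {i, j, k, l}) M) :
    fourTerm i j k l M ∈ matchings B ∧ evalR n (fourTerm i j k l M) = 0 := by
  obtain ⟨h1, e1⟩ := insert_insert_isMatching hB hne hM
  obtain ⟨h2, e2⟩ := insert_insert_isMatching (B := B) (i := i) (j := k) (k := j) (l := l)
    (M := M) (by tauto) (by grind) (by rwa [Finset.insert_comm k j])
  obtain ⟨h3, e3⟩ := insert_insert_isMatching (B := B) (i := i) (j := l) (k := j) (l := k)
    (M := M) (by tauto) (by grind) (by
      rwa [Finset.insert_comm l j, Finset.pair_comm l k])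
  refine ⟨add_mem (add_mem (single_mem_matchings h1 1) (single_mem_matchings h2 1))
    (single_mem_matchings h3 1), ?_⟩
  rw [fourTerm, map_add, map_add, evalR_single, evalR_single, evalR_single, one_smul, one_smul,
    one_smul, e1, e2, e3, ← add_mul, ← add_mul,
    mkR_bP_four_term hne.1 hne.2.1 hne.2.2.1 hne.2.2.2.1 hne.2.2.2.2.1 hne.2.2.2.2.2, zero_mul]

theorem fourTermSpan_le (B : Finset (Fin n)) :
    fourTermSpan B ≤ matchings B ⊓ LinearMap.ker (evalR n) := by
  refine Submodule.span_le.2 ?_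
  rintro _ ⟨i, j, k, l, M, hB, hne, hM, rfl⟩
  exact fourTerm_mem hB hne hM

/-- Adding the edge `{x, y}` to every monomial of a formal combination. -/
noncomputable def addEdge (x y : Fin n) :
    (Finset (Sym2 (Fin n)) →₀ ℚ) →ₗ[ℚ] (Finset (Sym2 (Fin n)) →₀ ℚ) :=
  Finsupp.lmapDomain ℚ ℚ (insert s(x, y))

theorem addEdge_single (x y : Fin n) (v : Finset (Sym2 (Fin n))) (q : ℚ) :
    addEdge x y (Finsupp.single v q) = Finsupp.single (insert s(x, y) v) q :=
  Finsupp.mapDomain_single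

theorem addEdge_mem_fourTermSpan {B : Finset (Fin n)} {x y : Fin n} (hx : x ∈ B) (hy : y ∈ B)
    (hxy : x ≠ y) {c : Finset (Sym2 (Fin n)) →₀ ℚ} (hc : c ∈ fourTermSpan (B \ {x, y})) :
    addEdge x y c ∈ fourTermSpan B := by
  suffices h : fourTermSpan (B \ {x, y}) ≤ (fourTermSpan B).comap (addEdge x y) from h hc
  refine Submodule.span_le.2 ?_
  rintro _ ⟨i, j, k, l, M, hB, hne, hM, rfl⟩
  refine Submodule.subset_span ⟨i, j, k, l, insert s(x, y) M, ?_, hne, ?_, ?_⟩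
  · simp only [Finset.mem_sdiff] at hB
    tauto
  · refine hM.insert hxy (by simp) (by simp) fun a => ?_
    simp only [Finset.mem_sdiff, Finset.mem_insert, Finset.mem_singleton] at hB ⊢
    grind
  · have comm (s t : Sym2 (Fin n)) : insert s(x, y) (insert s (insert t M)) =
        insert s (insert t (insert s(x, y) M)) := by
      rw [Finset.insert_comm, Finset.insert_comm s(x, y) t]
    simp only [fourTerm, map_add, addEdge_single, comm]

/-- The contraction of a matching along `{x, j}`: up to the factor `a_x a_j`, the product of the
associated monomial with `b_{x,j}`. -/
noncomputable def contract (x j : Fin n) (v : Finset (Sym2 (Fin n))) :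
    Finset (Sym2 (Fin n)) →₀ ℚ :=
  if j = partner v x then Finsupp.single (v.erase s(x, j)) (-2)
  else Finsupp.single (insert s(partner v x, partner v j)
    ((v.erase s(x, partner v x)).erase s(j, partner v j))) 1

theorem contract_mem_and_eval {B : Finset (Fin n)} {v : Finset (Sym2 (Fin n))}
    (hv : IsMatching n B v) {x j : Fin n} (hx : x ∈ B) (hj : j ∈ B) (hxj : x ≠ j) :
    contract x j v ∈ matchings (B \ {x, j}) ∧
      mkR n (bP n x j) * monR v =
        mkR n (aP n x) * mkR n (aP n j) * evalR n (contract x j v) := by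
  have hk := hv.mk_partner_mem hx
  have hl := hv.mk_partner_mem hj
  have hpx := hv.partner_mem hx
  have hpj := hv.partner_mem hj
  rw [contract]
  split_ifs with h
  · rw [← h] at hk
    refine ⟨single_mem_matchings (hv.erase hk) _, ?_⟩
    rw [evalR_single, monR_erase hk, ← mul_assoc, mkR_bP_sq hxj, mul_smul_comm,
      neg_smul, two_smul]
    ring
  · generalize hpk : partner v x = k at *
    generalize hpl : partner v j = l at *
    have hxk := hv.ne hk
    have hjl := hv.ne hl
    have hkl : k ≠ l := by
      rintro rfl
      rw [Sym2.eq_swap] at hk hl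
      exact hxj (hv.eq_right hk hl)
    have hxl : x ≠ l := by
      rintro rfl
      rw [Sym2.eq_swap] at hl
      exact h (hv.eq_right hl hk)
    have hl' : s(j, l) ∈ v.erase s(x, k) := by
      refine Finset.mem_erase.2 ⟨fun e => ?_, hl⟩
      rcases Sym2.eq_iff.1 e with ⟨e, -⟩ | ⟨e, -⟩
      exacts [hxj e.symm, h e]
    have hv1 := (hv.erase hk).erase hl'
    refine ⟨single_mem_matchings (hv1.insert hkl (by simp) (by simp) fun a => ?_) _, ?_⟩
    · simp only [Finset.mem_sdiff, Finset.mem_insert, Finset.mem_singleton]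
      grind
    · have e1 := mkR_bP_mul_bP hxj hxk h
      have e2 := mkR_bP_mul_bP h hjl hkl
      rw [evalR_single, one_smul, monR_insert (hv1.notMem_left (by simp) l), monR_erase hk,
        monR_erase hl']
      linear_combination (mkR n (bP n j l) * monR ((v.erase s(x, k)).erase s(j, l))) * e1
        + mkR n (aP n x) * monR ((v.erase s(x, k)).erase s(j, l)) * e2

theorem sum_addEdge_contract {B : Finset (Fin n)} {v : Finset (Sym2 (Fin n))}
    (hv : IsMatching n B v) {x : Fin n} (hx : x ∈ B) :
    2 • ∑ j ∈ B.erase x, addEdge x j (contract x j v) +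
      ((B.card : ℚ) + 2) • Finsupp.single v 1 ∈ fourTermSpan B := by
  have hk := hv.mk_partner_mem hx
  have hpx := hv.partner_mem hx
  generalize hpk : partner v x = k at *
  have hxk := hv.ne hk
  have hkB : k ∈ B.erase x := Finset.mem_erase.2 ⟨hxk.symm, hpx⟩
  have hv0 := hv.erase hk
  set v0 := v.erase s(x, k) with hv0def
  set C := (B.erase x).erase k with hC
  have hCB (a) : a ∈ C ↔ a ≠ k ∧ a ≠ x ∧ a ∈ B := by simp [hC]
  have hBC : B \ {x, k} = C := by
    ext a
    simp only [hCB, Finset.mem_sdiff, Finset.mem_insert, Finset.mem_singleton]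
    tauto
  rw [hBC] at hv0
  have hcard : (B.card : ℚ) = C.card + 2 := by
    have h1 := Finset.card_erase_add_one hkB
    have h2 := Finset.card_erase_add_one hx
    rw [← h2, ← h1]
    push_cast
    ring
  have hpart (j) (hj : j ∈ C) : partner v j = partner v0 j :=
    hv.partner_eq (Finset.mem_of_mem_erase (hv0.mk_partner_mem hj))
  let E (j : Fin n) : Finset (Sym2 (Fin n)) →₀ ℚ :=
    Finsupp.single (insert s(x, j) (insert s(k, partner v0 j) (v0.erase s(j, partner v0 j)))) 1
  have hE (j) (hj : j ∈ C) : addEdge x j (contract x j v) = E j := by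
    rw [contract, hpk, if_neg ((hCB j).1 hj).1, addEdge_single, hpart j hj]
  have hEk : addEdge x k (contract x k v) = (-2 : ℚ) • Finsupp.single v 1 := by
    rw [contract, hpk, if_pos rfl, addEdge_single, Finset.insert_erase hk]
    simp
  have hpair (j) (hj : j ∈ C) :
      E j + E (partner v0 j) + Finsupp.single v 1 ∈ fourTermSpan B := by
    have hjl := hv0.mk_partner_mem hj
    have hlC := hv0.partner_mem hj
    have hll := hv0.partner_partner hj
    generalize hl : partner v0 j = l at *
    have hne := hv0.ne hjl
    have h1 := (hCB j).1 hj
    have h2 := (hCB l).1 hlC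
    refine Submodule.subset_span ⟨x, j, k, l, v0.erase s(j, l), ⟨hx, h1.2.2, hpx, h2.2.2⟩,
      ⟨h1.2.1.symm, hxk, h2.2.1.symm, h1.1, hne, h2.1.symm⟩, ?_, ?_⟩
    · convert hv0.erase hjl using 1
      ext a
      simp only [hCB, Finset.mem_sdiff, Finset.mem_insert, Finset.mem_singleton]
      tauto
    · have hv' : insert s(x, k) (insert s(j, l) (v0.erase s(j, l))) = v := by
        rw [Finset.insert_erase hjl, hv0def, Finset.insert_erase hk]
      simp only [fourTerm, E, hl, hll, hv', Sym2.eq_swap (a := l) (b := j),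
        Sym2.eq_swap (a := k) (b := j)]
      abel
  have hinv : ∑ j ∈ C, E (partner v0 j) = ∑ j ∈ C, E j :=
    Finset.sum_nbij' (partner v0) (partner v0) (fun j hj => hv0.partner_mem hj)
      (fun j hj => hv0.partner_mem hj) (fun j hj => hv0.partner_partner hj)
      (fun j hj => hv0.partner_partner hj) (fun j hj => rfl)
  have hsum := Submodule.sum_mem _ hpair
  rw [Finset.sum_add_distrib, Finset.sum_add_distrib, hinv, Finset.sum_const] at hsum
  rw [← Finset.add_sum_erase _ _ hkB, hEk, Finset.sum_congr rfl hE, hcard]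
  convert hsum using 1
  rw [← Nat.cast_smul_eq_nsmul ℚ C.card]
  module

theorem mem_fourTermSpan_of_pairing_eq_zero (B : Finset (Fin n))
    {c : Finset (Sym2 (Fin n)) →₀ ℚ} (hc : c ∈ matchings B)
    (hpair : ∀ w, IsMatching n B w →
      (∏ i ∈ Bᶜ, mkR n (aP n i)) * (evalR n c * monR w) = 0) : c ∈ fourTermSpan B := by
  induction hd : B.card using Nat.strong_induction_on generalizing B c with
  | _ d ih =>
  subst hd
  rcases B.eq_empty_or_nonempty with rfl | ⟨x, hx⟩
  · have hc' : c = Finsupp.single ∅ (c ∅) := by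
      ext v
      rw [Finsupp.single_apply]
      split_ifs with h
      · rw [h]
      · by_contra h0
        exact h (isMatching_empty.1 (hc (Finsupp.mem_support_iff.2 h0))).symm
    have h := hpair ∅ (isMatching_empty.2 rfl)
    rw [hc', evalR_single, monR_empty, mul_one, mul_smul_comm, mul_one, Finset.compl_empty,
      ← map_prod] at h
    rcases smul_eq_zero.1 h with h | h
    · rw [hc', h, Finsupp.single_zero]
      exact zero_mem _
    · exact absurd h (prod_aP_ne_zero n)
  · let κ (j : Fin n) : (Finset (Sym2 (Fin n)) →₀ ℚ) →ₗ[ℚ] (Finset (Sym2 (Fin n)) →₀ ℚ) :=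
      Finsupp.linearCombination ℚ (contract x j)
    have hκ (j) (v) : κ j (Finsupp.single v 1) = contract x j v := by
      simp [κ]
    have hgen : matchings B =
        Submodule.span ℚ ((fun v => Finsupp.single v 1) '' {M | IsMatching n B M}) :=
      Finsupp.supported_eq_span_single ℚ _
    have hκ_mem (j) (hj : j ∈ B) (hxj : x ≠ j) : κ j c ∈ matchings (B \ {x, j}) := by
      suffices h : matchings B ≤ (matchings (B \ {x, j})).comap (κ j) from h hc
      rw [hgen, Submodule.span_le]
      rintro _ ⟨v, hv, rfl⟩
      simpa only [SetLike.mem_coe, Submodule.mem_comap, hκ] using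
        (contract_mem_and_eval hv hx hj hxj).1
    have hκ_eval (j) (hj : j ∈ B) (hxj : x ≠ j) : mkR n (bP n x j) * evalR n c =
        mkR n (aP n x) * mkR n (aP n j) * evalR n (κ j c) := by
      suffices h : matchings B ≤ LinearMap.eqLocus
          (LinearMap.mulLeft ℚ (mkR n (bP n x j)) ∘ₗ evalR n)
          (LinearMap.mulLeft ℚ (mkR n (aP n x) * mkR n (aP n j)) ∘ₗ evalR n ∘ₗ κ j) from h hc
      rw [hgen, Submodule.span_le]
      rintro _ ⟨v, hv, rfl⟩
      simpa [hκ, evalR_single, mul_assoc] using (contract_mem_and_eval hv hx hj hxj).2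
    have hκ_span (j) (hj : j ∈ B.erase x) : addEdge x j (κ j c) ∈ fourTermSpan B := by
      obtain ⟨hjx, hj⟩ := Finset.mem_erase.1 hj
      have hxj := hjx.symm
      refine addEdge_mem_fourTermSpan hx hj hxj
        (ih _ (Finset.card_lt_card ?_) _ (hκ_mem j hj hxj) (fun w hw => ?_) rfl)
      · exact Finset.sdiff_ssubset (Finset.insert_subset hx (Finset.singleton_subset_iff.2 hj))
          (Finset.insert_nonempty _ _)
      · have hw' : IsMatching n B (insert s(x, j) w) :=
          hw.insert hxj (by simp) (by simp) fun a => by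
            simp only [Finset.mem_sdiff, Finset.mem_insert, Finset.mem_singleton]
            grind
        have hcompl : (B \ {x, j})ᶜ = insert x (insert j Bᶜ) := by
          ext a
          simp only [Finset.mem_compl, Finset.mem_sdiff, Finset.mem_insert, Finset.mem_singleton]
          tauto
        have h := hpair _ hw'
        rw [monR_insert (hw.notMem_left (by simp) j)] at h
        rw [hcompl, Finset.prod_insert (by simp [hxj, hx]), Finset.prod_insert (by simp [hj])]
        linear_combination h - (∏ i ∈ Bᶜ, mkR n (aP n i)) * monR w * hκ_eval j hj hxj
    have hmain : 2 • ∑ j ∈ B.erase x, addEdge x j (κ j c) + ((B.card : ℚ) + 2) • c ∈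
        fourTermSpan B := by
      suffices h : matchings B ≤ (fourTermSpan B).comap
          (2 • ∑ j ∈ B.erase x, addEdge x j ∘ₗ κ j + ((B.card : ℚ) + 2) • LinearMap.id) by
        simpa [Finset.smul_sum] using h hc
      rw [hgen, Submodule.span_le]
      rintro _ ⟨v, hv, rfl⟩
      simpa [hκ, Finset.smul_sum] using sum_addEdge_contract hv hx
    have hcs := (Submodule.add_mem_iff_right _
      (Submodule.smul_of_tower_mem _ 2 (Submodule.sum_mem _ hκ_span))).1 hmain
    exact (Submodule.smul_mem_iff _ (by positivity)).1 hcs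

theorem evalR_mul_monR (c : Finset (Sym2 (Fin n)) →₀ ℚ) (w : Finset (Sym2 (Fin n))) :
    (c.sum fun v q => q • (mkR n (stdMon n ∅ v) * mkR n (stdMon n ∅ w))) = evalR n c * monR w := by
  rw [evalR, Finsupp.linearCombination_apply, Finsupp.sum, Finsupp.sum, Finset.sum_mul]
  simp only [monR, smul_mul_assoc]

end Relations

/-- For `m ≥ 2`, the kernel of the Gram matrix of the monomials of
`R_{2m}` associated to the perfect matchings of `{1,…,2m}` (i.e. the space of formal
ℚ-linear combinations `c` supported on perfect matchings such that
`Σ_v c_v (v·w) = 0` in `R_{2m}` for every matching monomial `w`) is exactly the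
ℚ-span of the formal elements
`(b_{ij}b_{kl} + b_{ik}b_{jl} + b_{il}b_{jk})·∏_{{p,q} ∈ M'} b_{pq}`, for `{i,j,k,l}`
a 4-element subset of `{1,…,2m}` and `M'` a perfect matching of its complement. -/
theorem gram_matrix_kernel (m : ℕ) (hm : 2 ≤ m) :
    { c : Finset (Sym2 (Fin (2 * m))) →₀ ℚ |
        (∀ M ∈ c.support, IsMatching (2 * m) Finset.univ M) ∧
        ∀ w : Finset (Sym2 (Fin (2 * m))), IsMatching (2 * m) Finset.univ w →
          (c.sum fun v q =>
            q • (mkR (2 * m) (stdMon (2 * m) ∅ v) * mkR (2 * m) (stdMon (2 * m) ∅ w))) = 0 }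
    = ↑(Submodule.span ℚ
      { e : Finset (Sym2 (Fin (2 * m))) →₀ ℚ |
          ∃ (i j k l : Fin (2 * m)) (M' : Finset (Sym2 (Fin (2 * m)))),
            i ≠ j ∧ i ≠ k ∧ i ≠ l ∧ j ≠ k ∧ j ≠ l ∧ k ≠ l ∧
            IsMatching (2 * m) (Finset.univ \ {i, j, k, l}) M' ∧
            e = Finsupp.single (insert s(i, j) (insert s(k, l) M')) (1 : ℚ)
              + Finsupp.single (insert s(i, k) (insert s(j, l) M')) (1 : ℚ)
              + Finsupp.single (insert s(i, l) (insert s(j, k) M')) (1 : ℚ) }) := by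
  have hspan : Submodule.span ℚ
      { e : Finset (Sym2 (Fin (2 * m))) →₀ ℚ |
          ∃ (i j k l : Fin (2 * m)) (M' : Finset (Sym2 (Fin (2 * m)))),
            i ≠ j ∧ i ≠ k ∧ i ≠ l ∧ j ≠ k ∧ j ≠ l ∧ k ≠ l ∧
            IsMatching (2 * m) (Finset.univ \ {i, j, k, l}) M' ∧
            e = Finsupp.single (insert s(i, j) (insert s(k, l) M')) (1 : ℚ)
              + Finsupp.single (insert s(i, k) (insert s(j, l) M')) (1 : ℚ)
              + Finsupp.single (insert s(i, l) (insert s(j, k) M')) (1 : ℚ) } =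
      fourTermSpan Finset.univ := by
    simp only [fourTermSpan, fourTerm, Finset.mem_univ, true_and, and_assoc]
  rw [hspan]
  ext c
  simp only [Set.mem_ofPred_eq, SetLike.mem_coe, evalR_mul_monR]
  constructor
  · rintro ⟨hc, h⟩
    exact mem_fourTermSpan_of_pairing_eq_zero _ (fun M hM => hc M hM) fun w hw => by
      rw [h w hw, mul_zero]
  · intro hc
    obtain ⟨h1, h2⟩ := fourTermSpan_le _ hc
    refine ⟨fun M hM => h1 hM, fun w _ => ?_⟩
    rw [LinearMap.mem_ker.1 h2, zero_mul]

end TautCt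
end

section
/- Suppose I_1,…,I_m are pairwise distinct subsets of {1,…,n}, each containing at most n−3 elements, such that every pair I_r, I_s satisfies condition (*): I_r ⊆ I_s, or I_s ⊆ I_r, or I_r ∪ I_s = {1,…,n}. If n ∉ I_1 ∩ … ∩ I_m, then exactly one of the minimal elements of the family {I_1,…,I_m} with respect to inclusion does not contain n. -/
namespace TautCt6

/-- If `I_1,…,I_m` are pairwise distinct subsets of `{1,…,n}` of
cardinality at most `n - 3` such that every pair satisfies condition (*)
(`I_r ⊆ I_s`, `I_s ⊆ I_r`, or `I_r ∪ I_s = {1,…,n}`), and the distinguished element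
`n` does not belong to `I_1 ∩ … ∩ I_m`, then exactly one minimal member of the family
(with respect to inclusion) does not contain `n`. Here `{1,…,n}` is modeled by
`Fin n` with distinguished element `⟨n-1, _⟩`. -/
theorem unique_root_not_containing_n (n m : ℕ) (hn : 1 ≤ n) (hm : 1 ≤ m)
    (I : Fin m → Finset (Fin n)) (hinj : Function.Injective I)
    (hcard : ∀ r, (I r).card ≤ n - 3)
    (hstar : ∀ r s, I r ⊆ I s ∨ I s ⊆ I r ∨ I r ∪ I s = Finset.univ)
    (hlast : ∃ r, (⟨n - 1, by omega⟩ : Fin n) ∉ I r) :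
    ∃! r : Fin m,
      (∀ s, I s ⊆ I r → I s = I r) ∧ (⟨n - 1, by omega⟩ : Fin n) ∉ I r := by
  obtain ⟨r, hr, hmin⟩ := Set.exists_min_image
    {r | (⟨n - 1, by omega⟩ : Fin n) ∉ I r} (fun r => (I r).card) (Set.toFinite _) hlast
  have hroot : ∀ s, I s ⊆ I r → I s = I r := fun s hs =>
    Finset.eq_of_subset_of_card_le hs (hmin s fun h => hr (hs h))
  refine ⟨r, ⟨hroot, hr⟩, ?_⟩
  rintro s ⟨hs, hns⟩
  apply hinj
  rcases hstar s r with h | h | h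
  · exact hroot s h
  · exact (hs r h).symm
  · exact ((Finset.mem_union.mp (h ▸ Finset.mem_univ _)).elim hns hr).elim

end TautCt6
end

section
/- Suppose I_1,…,I_m are pairwise distinct proper subsets of {1,…,n} such that every pair I_r, I_s satisfies condition (*): I_r ⊆ I_s, or I_s ⊆ I_r, or I_r ∪ I_s = {1,…,n}. Define a graph G on the vertex set {1,…,m} by joining r and s by an edge whenever I_s is a minimal element, with respect to inclusion, of the set {I_i : I_r ⊊ I_i, 1 ≤ i ≤ m} (or symmetrically with r and s exchanged). Then the graph G contains no cycles, i.e., G is a forest. -/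
namespace TautCt7

/-- A graph is acyclic if, for some rank function, every vertex has at most one neighbour of rank
at most its own: a vertex of maximal rank on a cycle would have two of them. -/
theorem isAcyclic_of_unique_lower_neighbor {V α : Type*} [LinearOrder α] {G : SimpleGraph V}
    (f : V → α)
    (h : ∀ v a b, G.Adj v a → G.Adj v b → f a ≤ f v → f b ≤ f v → a = b) :
    G.IsAcyclic := by
  classical
  intro u c hc
  obtain ⟨v, hv, hmax⟩ := c.support.toFinset.exists_max_image f ⟨u, by simp⟩
  rw [List.mem_toFinset] at hv
  have hc' : (c.rotate v hv).IsCycle := hc.rotate hv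
  have hle : ∀ w ∈ (c.rotate v hv).support, f w ≤ f v := fun w hw =>
    hmax w (by simpa [SimpleGraph.Walk.mem_support_rotate_iff] using hw)
  exact hc'.snd_ne_penultimate <| h v _ _
    (SimpleGraph.Walk.adj_snd hc'.not_nil) (SimpleGraph.Walk.adj_penultimate hc'.not_nil).symm
    (hle _ (SimpleGraph.Walk.getVert_mem_support _ _))
    (hle _ (SimpleGraph.Walk.getVert_mem_support _ _))

/-- Let `I_1,…,I_m` be pairwise distinct proper subsets of `{1,…,n}`
such that every pair satisfies condition (*). The graph on `{1,…,m}` joining `r` and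
`s` whenever `I_s` is a minimal element (w.r.t. inclusion) of `{I_i : I_r ⊊ I_i}`
(or symmetrically) is a forest, i.e. it contains no cycles. -/
theorem associated_graph_is_forest (n m : ℕ) (hn : 1 ≤ n) (hm : 1 ≤ m)
    (I : Fin m → Finset (Fin n)) (hinj : Function.Injective I)
    (hproper : ∀ r, I r ≠ Finset.univ)
    (hstar : ∀ r s, I r ⊆ I s ∨ I s ⊆ I r ∨ I r ∪ I s = Finset.univ) :
    (SimpleGraph.fromRel fun r s : Fin m =>
        I r ⊂ I s ∧ ∀ i, I r ⊂ I i → ¬ I i ⊂ I s).IsAcyclic := by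
  refine isAcyclic_of_unique_lower_neighbor (fun r => (I r).card) ?_
  rintro v a b ⟨-, ha⟩ ⟨-, hb⟩ hav hbv
  replace ha := ha.resolve_left fun h => (Finset.card_lt_card h.1).not_ge hav
  replace hb := hb.resolve_left fun h => (Finset.card_lt_card h.1).not_ge hbv
  apply hinj
  rcases hstar a b with hab | hba | hU
  · exact hab.eq_or_ssubset.resolve_right fun h => ha.2 b h hb.1
  · exact (hba.eq_or_ssubset.resolve_right fun h => hb.2 a h ha.1).symm
  · exact absurd (Finset.univ_subset_iff.mp (hU ▸ Finset.union_subset ha.1.1 hb.1.1)) (hproper v)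

end TautCt7
end

section
/- Suppose I_1,…,I_m are pairwise distinct subsets of {1,…,n}, each containing at most n−3 elements, such that every pair satisfies condition (*), and let G be the associated forest. Let i_1,…,i_m be arbitrary integers, and define, for each vertex r: j_r := |⋂_{s : I_r ⊊ I_s} I_s| − |I_r| + deg(r) − 1 − i_r if r is an internal vertex of G, and j_r := n − 1 − |I_r| − i_r if r is an external (maximal) vertex of G. Then for every vertex r, the equality Σ_{s : I_r ⊆ I_s} (i_s + j_s) = n − 1 − |I_r| holds, where the sum is over the closure of r in G. -/
namespace TautCt8

section Covers

variable {ι α : Type*} [Fintype ι] [DecidableEq α]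

/-- The heads of the edges leaving `r`: the minimal members of the family strictly above `I r`. -/
def covers (I : ι → Finset α) (r : ι) : Finset ι :=
  Finset.univ.filter fun s => I r ⊂ I s ∧ ∀ t, I r ⊂ I t → ¬ I t ⊂ I s

theorem mem_covers {I : ι → Finset α} {r s : ι} :
    s ∈ covers I r ↔ I r ⊂ I s ∧ ∀ t, I r ⊂ I t → ¬ I t ⊂ I s := by
  simp [covers]

theorem exists_mem_covers_subset (I : ι → Finset α) {r s : ι} (h : I r ⊂ I s) :
    ∃ t ∈ covers I r, I t ⊆ I s := by
  obtain ⟨t, ht, hmin⟩ := Finset.exists_min_image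
    (Finset.univ.filter fun t => I r ⊂ I t ∧ I t ⊆ I s) (fun t => (I t).card)
    ⟨s, by simp [h]⟩
  simp only [Finset.mem_filter, Finset.mem_univ, true_and] at ht hmin
  refine ⟨t, mem_covers.2 ⟨ht.1, fun u hu hut => ?_⟩, ht.2⟩
  exact (hmin u ⟨hu, hut.subset.trans ht.2⟩).not_gt (Finset.card_lt_card hut)

theorem union_eq_univ_of_mem_covers [Fintype α] {I : ι → Finset α} (hinj : Function.Injective I)
    (hstar : ∀ r s, I r ⊆ I s ∨ I s ⊆ I r ∨ I r ∪ I s = Finset.univ)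
    {r s t : ι} (hs : s ∈ covers I r) (ht : t ∈ covers I r) (hst : s ≠ t) :
    I s ∪ I t = Finset.univ := by
  rw [mem_covers] at hs ht
  rcases hstar s t with h | h | h
  · exact (ht.2 s hs.1 (h.ssubset_of_ne (hinj.ne hst))).elim
  · exact (hs.2 t ht.1 (h.ssubset_of_ne (hinj.ne hst.symm))).elim
  · exact h

theorem card_inf_add_sum_covers [Fintype α] {I : ι → Finset α} (hinj : Function.Injective I)
    (hstar : ∀ r s, I r ⊆ I s ∨ I s ⊆ I r ∨ I r ∪ I s = Finset.univ) (r : ι) :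
    ((Finset.univ.filter fun s => I r ⊂ I s).inf I).card
      + ∑ s ∈ covers I r, (I s)ᶜ.card = Fintype.card α := by
  rw [← Finset.card_add_card_compl ((Finset.univ.filter fun s => I r ⊂ I s).inf I),
    ← Finset.card_biUnion]
  · congr 2
    ext x
    simp only [Finset.mem_biUnion, Finset.mem_compl, Finset.mem_inf, Finset.mem_filter,
      Finset.mem_univ, true_and, not_forall]
    constructor
    · rintro ⟨s, hs, hx⟩
      exact ⟨s, (mem_covers.1 hs).1, hx⟩
    · rintro ⟨s, hs, hx⟩
      obtain ⟨t, ht, hts⟩ := exists_mem_covers_subset I hs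
      exact ⟨t, ht, fun h => hx (hts h)⟩
  · intro s hs t ht hst
    refine Finset.disjoint_left.2 fun x hxs hxt => ?_
    have hx := Finset.mem_univ x
    rw [← union_eq_univ_of_mem_covers hinj hstar hs ht hst] at hx
    simp_all

theorem sum_ssubset_eq_sum_covers [Fintype α] {M : Type*} [AddCommMonoid M]
    {I : ι → Finset α} (hinj : Function.Injective I) (huniv : ∀ r, I r ≠ Finset.univ)
    (hstar : ∀ r s, I r ⊆ I s ∨ I s ⊆ I r ∨ I r ∪ I s = Finset.univ) (r : ι) (f : ι → M) :
    ∑ s ∈ Finset.univ.filter (fun s => I r ⊂ I s), f s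
      = ∑ s ∈ covers I r, ∑ t ∈ Finset.univ.filter (fun t => I s ⊆ I t), f t := by
  classical
  rw [← Finset.sum_biUnion]
  · congr 1
    ext x
    simp only [Finset.mem_biUnion, Finset.mem_filter, Finset.mem_univ, true_and]
    exact ⟨exists_mem_covers_subset I, fun ⟨s, hs, hx⟩ => (mem_covers.1 hs).1.trans_subset hx⟩
  · intro s hs t ht hst
    refine Finset.disjoint_left.2 fun x hsx htx => huniv x ?_
    simp only [Finset.mem_filter, Finset.mem_univ, true_and] at hsx htx
    rw [← Finset.univ_subset_iff, ← union_eq_univ_of_mem_covers hinj hstar hs ht hst]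
    exact Finset.union_subset hsx htx

theorem sum_subset_eq_add_sum_ssubset {M : Type*} [AddCommMonoid M] {I : ι → Finset α}
    (hinj : Function.Injective I) (r : ι) (f : ι → M) :
    ∑ s ∈ Finset.univ.filter (fun s => I r ⊆ I s), f s
      = f r + ∑ s ∈ Finset.univ.filter (fun s => I r ⊂ I s), f s := by
  classical
  rw [← Finset.sum_insert (by simp)]
  congr 1
  ext x
  simp only [Finset.mem_insert, Finset.mem_filter, Finset.mem_univ, true_and]
  rw [le_iff_eq_or_lt, hinj.eq_iff, eq_comm]

end Covers

/-- Let `I_1,…,I_m` be pairwise distinct subsets of `{1,…,n}`, each of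
cardinality at most `n-3`, pairwise satisfying condition (*), with associated forest
`G`. For arbitrary integers `i_1,…,i_m` define `j_r` by
`j_r = |⋂_{I_r ⊊ I_s} I_s| - |I_r| + deg(r) - 1 - i_r` if `r` is internal, and
`j_r = n - 1 - |I_r| - i_r` if `r` is external (maximal). Then for every vertex `r`,
`Σ_{s : I_r ⊆ I_s} (i_s + j_s) = n - 1 - |I_r|`, the sum ranging over the closure
of `r` in `G`. -/
theorem closure_degree_sum (n m : ℕ) (hn : 1 ≤ n) (hm : 1 ≤ m)
    (I : Fin m → Finset (Fin n)) (hinj : Function.Injective I)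
    (hcard : ∀ r, (I r).card ≤ n - 3)
    (hstar : ∀ r s, I r ⊆ I s ∨ I s ⊆ I r ∨ I r ∪ I s = Finset.univ)
    (i j : Fin m → ℤ)
    (hj : ∀ r : Fin m, j r =
      if ∃ s, I r ⊂ I s then
        -- internal vertex: |⋂_{I_r ⊊ I_s} I_s| - |I_r| + deg(r) - 1 - i_r
        (((Finset.univ.filter fun s => I r ⊂ I s).inf I).card : ℤ) - ((I r).card : ℤ)
          + ((Finset.univ.filter fun s =>
                I r ⊂ I s ∧ ∀ t, I r ⊂ I t → ¬ I t ⊂ I s).card : ℤ)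
          - 1 - i r
      else
        -- external vertex: n - 1 - |I_r| - i_r
        (n : ℤ) - 1 - ((I r).card : ℤ) - i r) :
    ∀ r : Fin m,
      (∑ s ∈ Finset.univ.filter fun s => I r ⊆ I s, (i s + j s))
        = (n : ℤ) - 1 - ((I r).card : ℤ) := by
  have huniv : ∀ r, I r ≠ Finset.univ := fun r h => by
    have := hcard r
    rw [h, Finset.card_univ, Fintype.card_fin] at this
    omega
  intro r
  induction hk : n - (I r).card using Nat.strong_induction_on generalizing r with
  | _ k ih =>
    have hle : ∀ s, (I s).card ≤ n := fun s => by simpa using Finset.card_le_univ (I s)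
    rw [sum_subset_eq_add_sum_ssubset hinj, hj r]
    split_ifs with hr
    · rw [sum_ssubset_eq_sum_covers hinj huniv hstar]
      have hsum : ∀ s ∈ covers I r,
          ∑ t ∈ Finset.univ.filter (fun t => I s ⊆ I t), (i t + j t)
            = ((I s)ᶜ.card : ℤ) - 1 := fun s hs => by
        have hlt := Finset.card_lt_card (mem_covers.1 hs).1
        have hs_le := hle s
        rw [ih _ (by omega) s rfl, Finset.card_compl, Fintype.card_fin, Nat.cast_sub hs_le]
        ring
      rw [Finset.sum_congr rfl hsum, Finset.sum_sub_distrib]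
      have hcount := card_inf_add_sum_covers hinj hstar r
      rw [Fintype.card_fin] at hcount
      zify at hcount
      have hdeg : (Finset.univ.filter fun s => I r ⊂ I s ∧ ∀ t, I r ⊂ I t → ¬ I t ⊂ I s)
          = covers I r := by
        ext s
        rw [mem_covers, Finset.mem_filter]
        exact and_iff_right (Finset.mem_univ s)
      simp only [hdeg, Finset.sum_const, nsmul_eq_mul, mul_one]
      linarith
    · rw [Finset.sum_eq_zero fun s hs => (hr ⟨s, (Finset.mem_filter.1 hs).2⟩).elim]
      ring

end TautCt8
end
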